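/- arXiv:2304.09375 — 2 statements merged into one kernel-verified Lean document; each statement's English description precedes it below -/
import Mathlib

section
/- Let F_q be a finite field of odd order q, let t ∈ F_q with t ≠ 0, and let E ⊆ F_q^2 be nonempty. Define E'' = {u ∈ E : #{v ∈ E : ||u−v|| = t} ≥ 2|E|/q}. Then |E''| ≤ 4 q^3 / |E|. -/
open Finset

/-- `‖x‖ = x₁² + x₂²` for `x ∈ F_q²`. -/
def nrm {F : Type} [Field F] (x : F × F) : F := x.1 ^ 2 + x.2 ^ 2

theorem ks_alg {K : Type} [Field K] (Z Y b : K) (hZ : Z ≠ 0) (hY : Y ≠ 0) (q : ℕ) (hq : 2 ≤ q)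
    (h : Y ^ 2 = (1 - Z ^ (q-1)) * Y - b * Z ^ (2*q)) :
    (Z⁻¹) ^ q = Z⁻¹ + (Z⁻¹) ^ q * Y + b * ((Z⁻¹) ^ q * Y)⁻¹ := by
  obtain ⟨k, rfl⟩ : ∃ k, q = k + 1 := ⟨q - 1, by omega⟩
  simp only [Nat.add_sub_cancel] at h
  have e : Z ^ (2 * (k+1)) = (Z ^ k) ^ 2 * Z ^ 2 := by ring
  rw [e] at h
  simp only [inv_pow, pow_succ Z k]
  have hT : Z ^ k ≠ 0 := pow_ne_zero _ hZ
  generalize Z ^ k = T at *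
  field_simp
  linear_combination -h

theorem ks_series {F : Type} [Field F] (b : F) (q : ℕ) (hq : 2 ≤ q) :
    ∃ x y : HahnSeries ℤ F, x ≠ 0 ∧ y ≠ 0 ∧ x.order = -(q : ℤ) ∧ y.order = -1 ∧
      y ^ q = y + x + HahnSeries.C b * x⁻¹ := by
  classical
  have hH : HenselianRing (PowerSeries F) (Ideal.span {PowerSeries.X}) := inferInstance
  let X : PowerSeries F := PowerSeries.X
  let f : Polynomial (PowerSeries F) :=
    Polynomial.X ^ 2 + (Polynomial.C (-(1 - X ^ (q-1))) * Polynomial.X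
      + Polynomial.C (PowerSeries.C b * X ^ (2*q)))
  have hf : f.Monic := by
    apply Polynomial.monic_X_pow_add
    refine lt_of_le_of_lt (Polynomial.degree_linear_le) (by norm_num)
  have hX : X ∈ Ideal.span {PowerSeries.X} := Ideal.mem_span_singleton_self _
  have h1 : f.eval 1 ∈ Ideal.span {PowerSeries.X} := by
    have : f.eval 1 = X ^ (q-1) + PowerSeries.C b * X ^ (2*q) := by
      simp [f]; ring
    rw [this]
    exact Ideal.add_mem _ (Ideal.pow_mem_of_mem _ hX _ (by omega))
      (Ideal.mul_mem_left _ _ (Ideal.pow_mem_of_mem _ hX _ (by omega)))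
  have h2 : IsUnit (Ideal.Quotient.mk (Ideal.span {PowerSeries.X}) (f.derivative.eval 1)) := by
    have : f.derivative.eval 1 = 1 + X ^ (q-1) := by
      simp only [f, Polynomial.derivative_add, Polynomial.derivative_X_pow,
        Polynomial.derivative_C_mul, Polynomial.derivative_C, Polynomial.derivative_X]
      simp only [Polynomial.eval_add, Polynomial.eval_mul, Polynomial.eval_C, Polynomial.eval_pow,
        Polynomial.eval_X, Polynomial.eval_one, Polynomial.eval_zero, one_pow]
      push_cast
      ring
    rw [this, map_add, Ideal.Quotient.eq_zero_iff_mem.2 (Ideal.pow_mem_of_mem _ hX (q-1) (by omega))]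
    simp
  obtain ⟨ξ, hξ, hξ1⟩ := hH.is_henselian f hf 1 h1 h2
  have hξ' : ξ ^ 2 = (1 - X ^ (q-1)) * ξ - PowerSeries.C b * X ^ (2*q) := by
    have : f.eval ξ = 0 := hξ
    simp [f] at this
    linear_combination this
  have hc : PowerSeries.constantCoeff ξ = 1 := by
    rw [Ideal.mem_span_singleton, PowerSeries.X_dvd_iff] at hξ1
    simpa [sub_eq_zero] using hξ1
  let Z : HahnSeries ℤ F := HahnSeries.single 1 1
  have hZ : (HahnSeries.ofPowerSeries ℤ F X) = Z := HahnSeries.ofPowerSeries_X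
  let Ξ : HahnSeries ℤ F := HahnSeries.ofPowerSeries ℤ F ξ
  have hΞ : Ξ ^ 2 = (1 - Z ^ (q-1)) * Ξ - HahnSeries.C b * Z ^ (2*q) := by
    have := congrArg (HahnSeries.ofPowerSeries ℤ F) hξ'
    simp only [map_pow, map_sub, map_mul, map_one, hZ, HahnSeries.ofPowerSeries_C] at this
    exact this
  have hc0 : Ξ.coeff 0 = 1 := by
    have := HahnSeries.ofPowerSeries_apply_coeff (Γ := ℤ) ξ 0
    simp only [PowerSeries.coeff_zero_eq_constantCoeff, hc] at this
    exact_mod_cast this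
  have hΞ0 : Ξ ≠ 0 := by intro h; rw [h] at hc0; simp at hc0
  have hΞo : Ξ.order = 0 := by
    apply le_antisymm
    · apply HahnSeries.order_le_of_coeff_ne_zero; rw [hc0]; exact one_ne_zero
    · rw [HahnSeries.le_order_iff_forall hΞ0]
      intro j hj
      have := PowerSeries.coeff_coe (R := F) ξ j
      rw [if_pos hj] at this
      exact this
  have hZ0 : Z ≠ 0 := by simp [Z]
  have hZo : Z.order = 1 := HahnSeries.order_single one_ne_zero
  have hinv : ∀ w : HahnSeries ℤ F, w ≠ 0 → (w⁻¹).order = - w.order := by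
    intro w hw
    have := HahnSeries.order_mul hw (inv_ne_zero hw)
    rw [mul_inv_cancel₀ hw, HahnSeries.order_one] at this
    linarith
  refine ⟨(Z⁻¹) ^ q * Ξ, Z⁻¹, by positivity, by positivity, ?_, ?_, ?_⟩
  · rw [HahnSeries.order_mul (by positivity) hΞ0, HahnSeries.order_pow, hinv _ hZ0, hΞo, hZo]; simp
  · rw [hinv _ hZ0, hZo]
  · apply ks_alg _ _ _ hZ0 hΞ0 q hq hΞ

theorem ks_indep {F : Type} [Field F] {ι : Type} [DecidableEq ι] (s : Finset ι) (e : ι → HahnSeries ℤ F)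
    (he : ∀ i ∈ s, e i ≠ 0) (hinj : ∀ i ∈ s, ∀ j ∈ s, (e i).order = (e j).order → i = j)
    (c : ι → F) (h : ∑ i ∈ s, HahnSeries.C (c i) * e i = 0) : ∀ i ∈ s, c i = 0 := by
  classical
  by_contra! hne
  obtain ⟨i0, hi0, hci0⟩ := hne
  obtain ⟨i, hi, hmin⟩ := (s.filter (fun i => c i ≠ 0)).exists_min_image (fun i => (e i).order)
    ⟨i0, by simp [hi0, hci0]⟩
  simp only [Finset.mem_filter] at hi hmin
  have := congrArg (fun w : HahnSeries ℤ F => w.coeff (e i).order) h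
  simp only [HahnSeries.coeff_sum, HahnSeries.C_mul_eq_smul, HahnSeries.coeff_smul, HahnSeries.coeff_zero] at this
  rw [Finset.sum_eq_single i] at this
  · rw [smul_eq_mul, mul_eq_zero, HahnSeries.coeff_order_eq_zero] at this
    exact this.elim hi.2 (he i hi.1)
  · intro j hj hji
    by_cases hcj : c j = 0
    · simp [hcj]
    · have h1 := hmin j ⟨hj, hcj⟩
      have h2 : (e i).order ≠ (e j).order := fun h => hji (hinj i hi.1 j hj h).symm
      rw [HahnSeries.coeff_eq_zero_of_lt_order (lt_of_le_of_ne h1 h2), smul_zero]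
  · intro h; exact absurd hi.1 h

theorem ks_gen {F : Type} [Field F] (b : F) (q : ℕ) (hq : 2 ≤ q) :
    ∃ (L : Type) (_ : Field L) (_ : Algebra F L) (x y : L), x ≠ 0 ∧
      y ^ q = y + x + algebraMap F L b * x⁻¹ ∧
      ∀ (ι : Type) (s : Finset ι) (f g : ι → ℕ)
        (_ : ∀ i ∈ s, ∀ j ∈ s, q * f i + g i = q * f j + g j → i = j) (c : ι → F),
        ∑ i ∈ s, c i • (x ^ f i * y ^ g i) = 0 → ∀ i ∈ s, c i = 0 := by
  classical
  obtain ⟨x, y, hx, hy, ox, oy, h⟩ := ks_series b q hq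
  refine ⟨HahnSeries ℤ F, inferInstance, (HahnSeries.C : F →+* HahnSeries ℤ F).toAlgebra, x, y, hx, h, ?_⟩
  intro ι s f g hinj c hc
  apply ks_indep s (fun i => x ^ f i * y ^ g i)
  · intro i _; positivity
  · intro i hi j hj hij
    apply hinj i hi j hj
    simp only [HahnSeries.order_mul (pow_ne_zero _ hx) (pow_ne_zero _ hy), HahnSeries.order_pow, ox, oy] at hij
    zify
    simp at hij
    linarith
  · exact hc

def ksV (F : Type) [Field F] {R : Type} [CommRing R] [Algebra F R] (q : ℕ) (x : Rˣ) (y : R) (s D : ℤ) :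
    Submodule F R :=
  Submodule.span F ((fun p : ℤ × ℕ => ((x ^ p.1 : Rˣ) : R) * y ^ p.2) ''
    (↑(Finset.Icc (-s) D ×ˢ Finset.range q) : Set (ℤ × ℕ)))

section ksV
variable {F : Type} [Field F] {R : Type} [CommRing R] [Algebra F R] {q : ℕ} {x : Rˣ} {y : R}

theorem ksV_gen {s D i : ℤ} {j : ℕ} (h1 : -s ≤ i) (h2 : i ≤ D) (hj : j < q) :
    ((x ^ i : Rˣ) : R) * y ^ j ∈ ksV F q x y s D :=
  Submodule.subset_span ⟨(i, j), by simp [h1, h2, hj], rfl⟩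

theorem ksV_map {s D : ℤ} (V : Submodule F R) (a : R)
    (h : ∀ i j, -s ≤ i → i ≤ D → j < q → a * (((x ^ i : Rˣ) : R) * y ^ j) ∈ V) {v : R}
    (hv : v ∈ ksV F q x y s D) : a * v ∈ V := by
  have : ksV F q x y s D ≤ V.comap (LinearMap.mulLeft F a) := by
    apply Submodule.span_le.2
    rintro _ ⟨⟨i, j⟩, hp, rfl⟩
    simp at hp
    exact h i j hp.1.1 hp.1.2 hp.2
  exact this hv

theorem ksV_mono {s D s' D' : ℤ} (h1 : s ≤ s') (h2 : D ≤ D') : ksV F q x y s D ≤ ksV F q x y s' D' := by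
  apply Submodule.span_mono
  apply Set.image_mono
  intro p hp
  simp at hp ⊢
  omega

theorem ksV_x {s D : ℤ} (k : ℤ) {v : R} (hv : v ∈ ksV F q x y s D) :
    ((x ^ k : Rˣ) : R) * v ∈ ksV F q x y (s - k) (D + k) := by
  apply ksV_map _ _ _ hv
  intro i j h1 h2 h3
  rw [← mul_assoc, ← Units.val_mul, ← zpow_add]
  exact ksV_gen (by omega) (by omega) h3

theorem ksV_C {s D : ℤ} (b : F) {v : R} (hv : v ∈ ksV F q x y s D) :
    algebraMap F R b * v ∈ ksV F q x y s D := by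
  rw [← Algebra.smul_def]; exact Submodule.smul_mem _ _ hv

theorem ksV_y (b : F) (hq : 2 ≤ q) (hy : y ^ q = y + x + algebraMap F R b * ((x⁻¹ : Rˣ) : R))
    {s D : ℤ} {v : R} (hv : v ∈ ksV F q x y s D) :
    y * v ∈ ksV F q x y (s + 1) (D + 1) := by
  apply ksV_map _ _ _ hv
  intro i j h1 h2 h3
  rcases lt_or_eq_of_le (Nat.succ_le_of_lt h3) with h | h
  · have : y * (((x ^ i : Rˣ) : R) * y ^ j) = ((x ^ i : Rˣ) : R) * y ^ (j+1) := by ring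
    rw [this]
    exact ksV_gen (by omega) (by omega) h
  · have : y * (((x ^ i : Rˣ) : R) * y ^ j) = ((x ^ i : Rˣ) : R) * y ^ q := by
      rw [← h, Nat.succ_eq_add_one]; ring
    rw [this, hy]
    have e : ((x ^ i : Rˣ) : R) * (y + x + algebraMap F R b * ((x⁻¹ : Rˣ) : R)) =
      ((x ^ i : Rˣ) : R) * y ^ 1 + ((x ^ (i+1) : Rˣ) : R) * y ^ 0
        + algebraMap F R b * (((x ^ (i-1) : Rˣ) : R) * y ^ 0) := by
      rw [zpow_add, zpow_sub]; push_cast; simp only [zpow_one]; ring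
    rw [e]
    refine Submodule.add_mem _ (Submodule.add_mem _ ?_ ?_) (ksV_C _ ?_)
    · exact ksV_gen (by omega) (by omega) (by omega)
    · exact ksV_gen (by omega) (by omega) (by omega)
    · exact ksV_gen (by omega) (by omega) (by omega)

theorem ksV_finrank {s D : ℤ} : Module.finrank F (ksV F q x y s D) ≤ (D + 1 + s).toNat * q := by
  classical
  unfold ksV
  rw [← Finset.coe_image]
  refine (finrank_span_finset_le_card _).trans (Finset.card_image_le.trans ?_)
  simp

instance ksV_fin {s D : ℤ} : Module.Finite F (ksV F q x y s D) := by
  apply Module.Finite.span_of_finite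
  exact Set.Finite.image _ (Finset.finite_toSet _)

end ksV

theorem ks_frob_pow {F : Type} [Field F] [Fintype F] {R : Type} [CommRing R] [Algebra F R] (m : ℕ) (a : R) :
    ((FiniteField.frobeniusAlgHom F R) ^ m) a = a ^ (Fintype.card F) ^ m := by
  rw [AlgHom.coe_pow, FiniteField.coe_frobeniusAlgHom, pow_iterate]

theorem ks_ypow {F : Type} [Field F] [Fintype F] {R : Type} [CommRing R] [Algebra F R]
    {x : Rˣ} {y : R} (b : F)
    (hy : y ^ (Fintype.card F) = y + x + algebraMap F R b * ((x⁻¹ : Rˣ) : R)) (m : ℕ) :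
    y ^ (Fintype.card F) ^ m = y + ∑ i ∈ range m, ((x : R) ^ (Fintype.card F) ^ i
      + algebraMap F R b * ((x⁻¹ : Rˣ) : R) ^ (Fintype.card F) ^ i) := by
  induction m with
  | zero => simp
  | succ m ih =>
    rw [pow_succ', pow_mul, hy, ← ks_frob_pow, map_add, map_add, map_mul, AlgHom.commutes, sum_range_succ]
    simp only [ks_frob_pow, ih]
    ring

theorem ksV_ypow {F : Type} [Field F] [Fintype F] {R : Type} [CommRing R] [Algebra F R]
    {x : Rˣ} {y : R} (b : F) (hq : 2 ≤ Fintype.card F)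
    (hy : y ^ (Fintype.card F) = y + x + algebraMap F R b * ((x⁻¹ : Rˣ) : R)) (m : ℕ) (l : ℕ)
    {s D : ℤ} {v : R} (hv : v ∈ ksV F (Fintype.card F) x y s D) :
    (y ^ (Fintype.card F) ^ (m+1)) ^ l * v ∈
      ksV F (Fintype.card F) x y (s + l * (Fintype.card F) ^ m) (D + l * (Fintype.card F) ^ m) := by
  set q := Fintype.card F
  have hone : ∀ {s D : ℤ} {v : R} (hv : v ∈ ksV F q x y s D),
      y ^ q ^ (m+1) * v ∈ ksV F q x y (s + q ^ m) (D + q ^ m) := by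
    intro s D v hv
    have hqm : 1 ≤ (q:ℤ) ^ m := by exact_mod_cast Nat.one_le_pow _ _ (by omega)
    rw [ks_ypow b hy, add_mul, sum_mul]
    refine Submodule.add_mem _ (ksV_mono (by omega) (by omega) (ksV_y b hq hy hv)) ?_
    refine Submodule.sum_mem _ fun i hi => ?_
    have hi : i ≤ m := by simp at hi; omega
    have hqi : (q:ℤ) ^ i ≤ (q:ℤ)^m := by exact_mod_cast Nat.pow_le_pow_right (by omega) hi
    have hqi0 : 0 ≤ (q:ℤ) ^ i := by positivity
    rw [add_mul, mul_assoc]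
    refine Submodule.add_mem _ ?_ (ksV_C _ ?_)
    · have := ksV_x ((q ^ i : ℕ) : ℤ) hv
      rw [zpow_natCast] at this
      push_cast at this
      exact ksV_mono (by omega) (by omega) this
    · have := ksV_x (-((q ^ i : ℕ) : ℤ)) hv
      rw [zpow_neg, zpow_natCast, ← inv_pow] at this
      push_cast at this
      exact ksV_mono (by omega) (by omega) this
  induction l with
  | zero => simpa using hv
  | succ l ih =>
    have := hone ih
    rw [pow_succ', mul_assoc]
    convert this using 2 <;> push_cast <;> ring

theorem ksV_poly {F : Type} [Field F] {R : Type} [CommRing R] [Algebra F R] {q : ℕ} {x : Rˣ} {y : R}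
    (r D : ℕ) {v : R} (hv : v ∈ ksV F q x y r D) :
    ∃ h : ℕ → Polynomial F, (∀ j, (h j).natDegree ≤ D + r) ∧
      (x : R) ^ r * v = ∑ j ∈ range q, Polynomial.aeval (x : R) (h j) * y ^ j := by
  unfold ksV at hv
  rw [Submodule.mem_span_image_finset_iff_exists_fun'] at hv
  obtain ⟨a, ha⟩ := hv
  refine ⟨fun j => ∑ i ∈ Icc (-(r:ℤ)) D, Polynomial.C (a (i, j)) * Polynomial.X ^ (i + r).toNat, ?_, ?_⟩
  · intro j
    apply Polynomial.natDegree_sum_le_of_forall_le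
    intro i hi
    refine (Polynomial.natDegree_C_mul_X_pow_le _ _).trans ?_
    simp at hi
    omega
  · rw [← ha, sum_product_right, mul_sum]
    apply sum_congr rfl
    intro j hj
    rw [mul_sum, map_sum, sum_mul]
    apply sum_congr rfl
    intro i hi
    simp only [map_mul, Polynomial.aeval_C, map_pow, Polynomial.aeval_X, Algebra.smul_def]
    have : ((x ^ (i + r).toNat : Rˣ) : R) = ((x ^ r : Rˣ) : R) * ((x ^ i : Rˣ) : R) := by
      rw [← Units.val_mul, ← zpow_natCast, ← zpow_natCast, ← zpow_add]
      congr 2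
      simp at hi
      omega
    push_cast at this
    rw [this]; ring

theorem ks_aux {F : Type} [Field F] [Fintype F] (b c : F) (hq : 3 ≤ Fintype.card F) (m q ρ r : ℕ)
    (hqq : q = Fintype.card F) (hρ : ρ = q ^ m) (hr : r = q ^ (m + 1))
    (Ω : Type) [Field Ω] [Algebra F Ω] :
    ∃ h : ℕ → Polynomial F, (∃ j < q, h j ≠ 0) ∧ (∀ j, (h j).natDegree ≤ r * ρ + 6 * r) ∧
      ∀ x y : Ω, x ≠ 0 → y ^ q = y + x + algebraMap F Ω b * x⁻¹ → x ^ (r * r) = x →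
        y ^ (r * r) = y + algebraMap F Ω c → 
        ∑ j ∈ range q, Polynomial.aeval x (h j) * y ^ j = 0 := by
  classical
  subst hqq
  set q := Fintype.card F with hqdef
  have hrρ : r = q * ρ := by rw [hr, hρ]; ring
  have hρ1 : 1 ≤ ρ := by rw [hρ]; exact Nat.one_le_pow _ _ (by omega)
  have hr3 : 3 * ρ ≤ r := by rw [hrρ]; exact Nat.mul_le_mul_right _ hq
  obtain ⟨L, _, _, xL, yL, hxL, hyL, hind⟩ := ks_gen b q (by omega)
  let Pts := {p : Ω × Ω // p.1 ≠ 0 ∧ p.2 ^ q = p.2 + p.1 + algebraMap F Ω b * p.1⁻¹ ∧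
    p.1 ^ (r * r) = p.1 ∧ p.2 ^ (r * r) = p.2 + algebraMap F Ω c}
  let R := L × (Pts → Ω)
  let x : Rˣ := ⟨(xL, fun p => p.1.1), (xL⁻¹, fun p => p.1.1⁻¹),
    Prod.ext (mul_inv_cancel₀ hxL) (funext fun p => mul_inv_cancel₀ p.2.1),
    Prod.ext (inv_mul_cancel₀ hxL) (funext fun p => inv_mul_cancel₀ p.2.1)⟩
  let y : R := (yL, fun p => p.1.2)
  have hy : y ^ q = y + x + algebraMap F R b * ((x⁻¹ : Rˣ) : R) :=
    Prod.ext hyL (funext fun p => p.2.2.1)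
  let s : Finset ((ℕ × ℕ) × (ℕ × ℕ)) := (range ρ ×ˢ range q) ×ˢ (range (ρ + 3) ×ˢ range q)
  have hlρ : ∀ l < q, (l : ℤ) * q ^ m ≤ r := by
    intro l hl
    have : l * q ^ m ≤ r := by
      rw [← hρ, hrρ]; exact Nat.mul_le_mul_right _ hl.le
    exact_mod_cast this
  -- the linear map
  let w : s → R := fun p => (x : R) ^ (r * p.1.1.1) * ((y ^ r) ^ p.1.1.2 *
    ((x : R) ^ p.1.2.1 * (y + algebraMap F R c) ^ p.1.2.2))
  have hw : ∀ p, w p ∈ ksV F q x y r ((r * ρ + ρ + 2 : ℕ)) := by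
    rintro ⟨⟨⟨k, l⟩, ⟨i, j⟩⟩, hp⟩
    simp only [s, mem_product, mem_range] at hp
    obtain ⟨⟨hk, hl⟩, hi, hj⟩ := hp
    have h1 : (x : R) ^ i * (y + algebraMap F R c) ^ j ∈ ksV F q x y 0 (ρ + 2 : ℕ) := by
      rw [add_pow, mul_sum]
      refine Submodule.sum_mem _ fun t ht => ?_
      have e : (x : R) ^ i * (y ^ t * algebraMap F R c ^ (j - t) * (j.choose t : ℕ)) =
        algebraMap F R (c ^ (j - t) * (j.choose t : ℕ)) * (((x ^ (i : ℤ) : Rˣ) : R) * y ^ t) := by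
        simp only [map_mul, map_pow, map_natCast, zpow_natCast, Units.val_pow_eq_pow_val]
        ring
      rw [e]
      simp at ht
      exact ksV_C _ (ksV_gen (by omega) (by omega) (by omega))
    have h2 := ksV_ypow b (by omega) hy m l h1
    rw [← hqdef, ← hr] at h2
    have h3 := ksV_x ((r * k : ℕ) : ℤ) h2
    rw [zpow_natCast, Units.val_pow_eq_pow_val] at h3
    refine ksV_mono ?_ ?_ h3
    · have := hlρ l hl
      push_cast
      have : (0:ℤ) ≤ r * k := by positivity
      omega
    · have := hlρ l hl
      have h4 : r * (k + 1) ≤ r * ρ := Nat.mul_le_mul_left _ hk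
      push_cast
      zify at h4
      linarith
  let V := ksV F q x y r ((r * ρ + ρ + 2 : ℕ))
  let Φ : (s → F) →ₗ[F] V := LinearMap.codRestrict V (Fintype.linearCombination F w) (by
    intro f
    rw [Fintype.linearCombination_apply]
    exact Submodule.sum_mem _ fun p _ => Submodule.smul_mem _ _ (hw p))
  have hlt : Module.finrank F V < Module.finrank F (s → F) := by
    refine lt_of_le_of_lt ksV_finrank ?_
    rw [Module.finrank_fintype_fun_eq_card, Fintype.card_coe]
    simp only [s, card_product, card_range]
    have e1 : ((((r * ρ + ρ + 2 : ℕ) : ℤ) + 1 + r).toNat) = r * ρ + ρ + 3 + r := by omega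
    rw [e1]
    have e2 : ρ * q * ((ρ + 3) * q) = (r * (ρ + 3)) * q := by rw [hrρ]; ring
    rw [e2]
    apply Nat.mul_lt_mul_of_pos_right _ (by omega)
    nlinarith
  obtain ⟨f, hf, hf0⟩ := (Submodule.ne_bot_iff _).1 (LinearMap.ker_ne_bot_of_finrank_lt (f := Φ) hlt)
  have hW : ∑ p, f p • w p = 0 := by
    have := congrArg Subtype.val (LinearMap.mem_ker.1 hf)
    simpa [Φ, Fintype.linearCombination_apply] using this
  -- the auxiliary function
  let u : s → R := fun p => (x : R) ^ (r * p.1.2.1) * ((y ^ r) ^ p.1.2.2 *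
    ((x : R) ^ p.1.1.1 * y ^ p.1.1.2))
  have hu : ∀ p, u p ∈ ksV F q x y r ((r * (ρ + 3) + ρ : ℕ)) := by
    rintro ⟨⟨⟨k, l⟩, ⟨i, j⟩⟩, hp⟩
    simp only [s, mem_product, mem_range] at hp
    obtain ⟨⟨hk, hl⟩, hi, hj⟩ := hp
    have h1 : (x : R) ^ k * y ^ l ∈ ksV F q x y 0 (ρ : ℕ) := by
      have := ksV_gen (F := F) (x := x) (y := y) (s := 0) (D := ρ) (i := k) (j := l) (q := q)
        (by omega) (by omega) hl
      rwa [zpow_natCast, Units.val_pow_eq_pow_val] at this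
    have h2 := ksV_ypow b (by omega) hy m j h1
    rw [← hqdef, ← hr] at h2
    have h3 := ksV_x ((r * i : ℕ) : ℤ) h2
    rw [zpow_natCast, Units.val_pow_eq_pow_val] at h3
    refine ksV_mono ?_ ?_ h3
    · have := hlρ j hj
      push_cast
      have : (0:ℤ) ≤ r * i := by positivity
      omega
    · have := hlρ j hj
      have h4 : r * (i + 1) ≤ r * (ρ + 3) := Nat.mul_le_mul_left _ hi
      push_cast
      zify at h4
      linarith
  obtain ⟨h, hdeg, hH⟩ := ksV_poly r (r * (ρ + 3) + ρ) (v := ∑ p, f p • u p)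
    (Submodule.sum_mem _ fun p _ => Submodule.smul_mem _ _ (hu p))
  refine ⟨h, ?_, ?_, ?_⟩
  · by_contra! hall
    have h0 : (x : R) ^ r * ∑ p, f p • u p = 0 := by
      rw [hH]
      apply sum_eq_zero
      intro j hj
      rw [hall j (mem_range.1 hj)]; simp
    have h1 : ∑ p, f p • u p = 0 := by
      have hx : IsUnit ((x : R) ^ r) := x.isUnit.pow r
      exact (hx.mul_right_eq_zero).1 h0
    have h2 := congrArg (AlgHom.fst F L (Pts → Ω)) h1
    rw [map_sum, map_zero] at h2
    apply hf0
    funext p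
    refine hind s univ (fun p => r * p.1.2.1 + p.1.1.1) (fun p => r * p.1.2.2 + p.1.1.2) ?_ f ?_ p (mem_univ _)
    · rintro ⟨⟨⟨k, l⟩, ⟨i, j⟩⟩, hp⟩ - ⟨⟨⟨k', l'⟩, ⟨i', j'⟩⟩, hp'⟩ - he
      simp only [s, mem_product, mem_range] at hp hp'
      obtain ⟨⟨hk, hl⟩, hi, hj⟩ := hp
      obtain ⟨⟨hk', hl'⟩, hi', hj'⟩ := hp'
      simp only at he
      have hlt : ∀ k l, k < ρ → l < q → q * k + l < r := by
        intro k l hk hl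
        have : q * (k + 1) ≤ q * ρ := Nat.mul_le_mul_left _ hk
        rw [hrρ]; linarith
      have e : (q * k + l) + r * (q * i + j) = (q * k' + l') + r * (q * i' + j') := by linarith
      have e1 : q * k + l = q * k' + l' := by
        have := congrArg (· % r) e
        simpa [Nat.add_mul_mod_self_left, Nat.mod_eq_of_lt (hlt _ _ hk hl), Nat.mod_eq_of_lt (hlt _ _ hk' hl')] using this
      have e2 : q * i + j = q * i' + j' := by
        rw [e1] at e
        have := Nat.add_left_cancel e
        exact Nat.eq_of_mul_eq_mul_left (by omega) this
      have aux : ∀ a b a' b', b < q → b' < q → q * a + b = q * a' + b' → a = a' ∧ b = b' := by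
        intro a b a' b' hb hb' h
        have h1 : b = b' := by
          have := congrArg (· % q) h
          simpa [Nat.mul_add_mod, Nat.mod_eq_of_lt hb, Nat.mod_eq_of_lt hb'] using this
        subst h1
        exact ⟨Nat.eq_of_mul_eq_mul_left (by omega) (Nat.add_right_cancel h), rfl⟩
      obtain ⟨rfl, rfl⟩ := aux _ _ _ _ hl hl' e1
      obtain ⟨rfl, rfl⟩ := aux _ _ _ _ hj hj' e2
      rfl
    · rw [← h2]
      apply sum_congr rfl
      intro p _
      rw [map_smul]
      congr 1
      simp only [u, map_mul, map_pow]
      have ex : (AlgHom.fst F L (Pts → Ω)) (x : R) = xL := rfl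
      have ey : (AlgHom.fst F L (Pts → Ω)) y = yL := rfl
      rw [ex, ey, pow_add, pow_add, pow_mul, pow_mul]
      ring
  · intro j
    refine (hdeg j).trans ?_
    nlinarith
  · intro x0 y0 hx0 hy0 hx1 hy1
    let p0 : Pts := ⟨(x0, y0), hx0, hy0, hx1, hy1⟩
    let π : R →ₐ[F] Ω := (Pi.evalAlgHom F (fun _ : Pts => Ω) p0).comp (AlgHom.snd F L (Pts → Ω))
    have ex : π (x : R) = x0 := rfl
    have ey : π y = y0 := rfl
    have h1 := congrArg π hH
    have h2 := congrArg π hW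
    rw [map_mul, map_sum, map_sum, map_pow, ex] at h1
    simp only [map_mul, map_pow, ey, ← Polynomial.aeval_algHom_apply, ex] at h1
    rw [← h1]
    apply mul_eq_zero_of_right
    have h3 : (∑ p, π (f p • u p)) ^ r = 0 := by
      rw [hr, ← ks_frob_pow, map_sum, ← map_zero π, ← h2, map_sum]
      apply sum_congr rfl
      intro p _
      rw [map_smul, map_smul, map_smul, ks_frob_pow, ← hqdef, ← hr]
      congr 1
      simp only [u, w, map_mul, map_pow, map_add, ex, ey, AlgHom.commutes]
      simp only [mul_pow]
      rw [← pow_mul, mul_right_comm r, pow_mul x0, hx1]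
      have : ((y0 ^ r) ^ p.1.2.2) ^ r = (y0 + algebraMap F Ω c) ^ p.1.2.2 := by
        rw [← hy1, ← pow_mul, ← pow_mul, ← pow_mul]; congr 1; ring
      rw [this, pow_mul' x0 r, pow_right_comm y0 r]
      ring
    exact pow_eq_zero_iff (by omega) |>.1 h3

theorem ks_count {F E : Type} [Field F] [Fintype F] [Field E] [Fintype E] [DecidableEq F] [DecidableEq E]
    [Algebra F E] (b c : F)
    (hq : 3 ≤ Fintype.card F) (m : ℕ) (hfin : Module.finrank F E = 2 * (m + 1)) :
    (univ.filter (fun x : E => x ≠ 0 ∧ Algebra.trace F E (x + algebraMap F E b * x⁻¹) = c)).card ≤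
      Fintype.card F ^ (m+1) * Fintype.card F ^ m + 6 * Fintype.card F ^ (m+1) := by
  obtain ⟨h, ⟨j, hj, hj0⟩, hdeg, hpt⟩ := ks_aux b c hq m _ _ _ rfl rfl rfl (AlgebraicClosure E)
  set q := Fintype.card F with hqdef
  set Ω := AlgebraicClosure E
  have hm0 : (h j).map (algebraMap F E) ≠ 0 := (Polynomial.map_ne_zero_iff (algebraMap F E).injective).2 hj0
  refine (Polynomial.card_le_degree_of_subset_roots (p := (h j).map (algebraMap F E)) ?_).trans ?_
  · intro x hx
    simp only [mem_val, mem_filter, mem_univ, true_and] at hx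
    obtain ⟨hx0, htr⟩ := hx
    rw [Polynomial.mem_roots hm0, Polynomial.IsRoot, Polynomial.eval_map_algebraMap]
    apply (algebraMap E Ω).injective
    rw [map_zero, ← Polynomial.aeval_algebraMap_apply]
    set X : Ω := algebraMap E Ω x with hX
    have hX0 : X ≠ 0 := by rw [hX]; simpa using hx0
    have hcardE : Fintype.card E = q ^ (m+1) * q ^ (m+1) := by
      rw [Module.card_eq_pow_finrank (K := F), hfin, two_mul, pow_add]
    have hX1 : X ^ (q ^ (m+1) * q ^ (m+1)) = X := by
      rw [hX, ← map_pow, ← hcardE, FiniteField.pow_card]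
    -- every root works
    have hy : ∀ y : Ω, y ^ q = y + X + algebraMap F Ω b * X⁻¹ →
        ∑ j ∈ range q, Polynomial.aeval X (h j) * y ^ j = 0 := by
      intro y hy
      refine hpt X y hX0 hy hX1 ?_
      have h1 := ks_ypow (x := Units.mk0 X hX0) (y := y) b (by simpa using hy) (2 * (m+1))
      rw [← hqdef] at h1
      rw [← pow_add, ← two_mul, h1]
      congr 1
      rw [← htr, IsScalarTower.algebraMap_apply F E (AlgebraicClosure E) (Algebra.trace F E _), FiniteField.algebraMap_trace_eq_sum_pow, hfin, map_sum]
      apply sum_congr rfl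
      intro i _
      have e : (x + algebraMap F E b * x⁻¹) ^ (Nat.card F ^ i)
          = x ^ q ^ i + algebraMap F E b * x⁻¹ ^ q ^ i := by
        rw [Nat.card_eq_fintype_card, ← ks_frob_pow, map_add, map_mul, AlgHom.commutes, ks_frob_pow,
          ks_frob_pow]
      rw [e, IsScalarTower.algebraMap_apply F E (AlgebraicClosure E) b]
      simp [hX, Ω]
    obtain ⟨y, hy0⟩ : ∃ y : Ω, y ^ q = y + X + algebraMap F Ω b * X⁻¹ := by
      have hd : (Polynomial.X ^ q + (-Polynomial.X - Polynomial.C (X + algebraMap F Ω b * X⁻¹)) : Polynomial Ω).degree = q := by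
        rw [Polynomial.degree_add_eq_left_of_degree_lt, Polynomial.degree_X_pow]
        rw [Polynomial.degree_X_pow]
        refine lt_of_le_of_lt (Polynomial.degree_sub_le _ _) ?_
        rw [Polynomial.degree_neg, Polynomial.degree_X]
        refine max_lt ?_ (lt_of_le_of_lt Polynomial.degree_C_le ?_)
        · exact_mod_cast (by omega : 1 < q)
        · exact_mod_cast (by omega : 0 < q)
      obtain ⟨y, hy⟩ := IsAlgClosed.exists_root _ (show _ ≠ 0 by rw [hd]; exact_mod_cast (by omega : q ≠ 0))
      refine ⟨y, ?_⟩
      simp [Polynomial.IsRoot] at hy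
      linear_combination hy
    let g : Polynomial Ω := ∑ j ∈ range q, Polynomial.C (Polynomial.aeval X (h j)) * Polynomial.X ^ j
    have hg : g = 0 := by
      apply Polynomial.eq_zero_of_natDegree_lt_card_of_eval_eq_zero g (f := fun a : F => y + algebraMap F Ω a)
      · intro a a' haa
        exact (algebraMap F Ω).injective (add_left_cancel haa)
      · intro a
        have := hy (y + algebraMap F Ω a) (by
          have e : (y + algebraMap F Ω a) ^ q = y ^ q + algebraMap F Ω a := by
            have := map_add (FiniteField.frobeniusAlgHom F Ω) y (algebraMap F Ω a)
            rw [AlgHom.commutes] at this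
            exact this
          rw [e, hy0]; ring)
        rw [← this]
        simp [g, Polynomial.eval_finsetSum]
      · rw [← hqdef]
        refine lt_of_le_of_lt (Polynomial.natDegree_sum_le_of_forall_le (n := q - 1) _ _ ?_) (by omega)
        intro i hi
        refine (Polynomial.natDegree_C_mul_X_pow_le _ _).trans ?_
        simp at hi; omega
    have := congrArg (fun p => Polynomial.coeff p j) hg
    simpa [g, Polynomial.finsetSum_coeff, Polynomial.coeff_X_pow, hj] using this
  · exact (Polynomial.natDegree_map_le).trans (hdeg j)

theorem ks_rough {F E : Type} [Field F] [Fintype F] [Field E] [Fintype E] [DecidableEq F] [DecidableEq E]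
    [Algebra F E] (b : F) (ψ : AddChar F ℂ) (hψ : ψ ≠ 1)
    (hq : 3 ≤ Fintype.card F) (m : ℕ) (hfin : Module.finrank F E = 2 * (m + 1)) :
    ‖∑ x ∈ univ.filter (fun x : E => x ≠ 0), ψ (Algebra.trace F E (x + algebraMap F E b * x⁻¹))‖ ≤
      6 * (Fintype.card F : ℝ) ^ 2 * (Fintype.card F : ℝ) ^ (m+1) := by
  set q := Fintype.card F with hqdef
  let Z : F → ℕ := fun c =>
    (univ.filter (fun x : E => x ≠ 0 ∧ Algebra.trace F E (x + algebraMap F E b * x⁻¹) = c)).card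
  have hZ : ∀ c, (Z c : ℝ) ≤ (q:ℝ) ^ (m+1) * q ^ m + 6 * q ^ (m+1) := by
    intro c
    exact_mod_cast ks_count b c hq m hfin
  have hsum : ∑ c, (Z c : ℝ) = (q:ℝ) ^ (m+1) * q ^ (m+1) - 1 := by
    have h1 : ∑ c, Z c = (univ.filter (fun x : E => x ≠ 0)).card := by
      rw [card_eq_sum_card_fiberwise (f := fun x => Algebra.trace F E (x + algebraMap F E b * x⁻¹)) (t := univ) (by simp)]
      simp [Z, filter_filter]
    have h2 : (univ.filter (fun x : E => x ≠ 0)).card + 1 = q ^ (m+1) * q ^ (m+1) := by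
      rw [filter_ne', card_erase_add_one (mem_univ _), card_univ, Module.card_eq_pow_finrank (K := F), hfin, two_mul, pow_add]
    rw [← h1] at h2
    have : ((∑ c, Z c : ℕ) : ℝ) + 1 = (q:ℝ) ^ (m+1) * q ^ (m+1) := by exact_mod_cast h2
    push_cast at this
    linarith
  have hq3 : (3:ℝ) ≤ q := by exact_mod_cast hq
  have hr1 : (1:ℝ) ≤ (q:ℝ) ^ (m+1) := one_le_pow₀ (by linarith)
  have habs : ∀ c, |(Z c : ℝ) - (q:ℝ) ^ (m+1) * q ^ m| ≤ 6 * q * (q:ℝ) ^ (m+1) := by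
    intro c
    rw [abs_le]
    constructor
    · have h1 := Finset.add_sum_erase univ (fun c => (Z c : ℝ)) (mem_univ c)
      have h2 : ∑ c ∈ univ.erase c, (Z c : ℝ) ≤ ((q:ℝ) - 1) * ((q:ℝ) ^ (m+1) * q ^ m + 6 * q ^ (m+1)) := by
        refine (sum_le_card_nsmul _ _ _ (fun c _ => hZ c)).trans ?_
        rw [card_erase_of_mem (mem_univ _), card_univ, ← hqdef, nsmul_eq_mul, Nat.cast_sub (by omega)]
        simp
      rw [hsum] at h1
      have e : (q:ℝ) ^ (m+1) * q ^ (m+1) = q * ((q:ℝ) ^ (m+1) * q ^ m) := by ring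
      nlinarith
    · have := hZ c
      nlinarith
  have hmain : ∑ x ∈ univ.filter (fun x : E => x ≠ 0), ψ (Algebra.trace F E (x + algebraMap F E b * x⁻¹))
      = ∑ c, ψ c * (((Z c : ℝ) - (q:ℝ) ^ (m+1) * q ^ m : ℝ) : ℂ) := by
    rw [← sum_fiberwise_of_maps_to (g := fun x => Algebra.trace F E (x + algebraMap F E b * x⁻¹)) (t := univ) (by simp)]
    have h0 : ∑ c, ψ c = 0 := AddChar.sum_eq_zero_of_ne_one hψ
    have : ∑ c, ψ c * (((Z c : ℝ) - (q:ℝ) ^ (m+1) * q ^ m : ℝ) : ℂ) = ∑ c, ψ c * (Z c : ℂ) := by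
      push_cast
      simp only [mul_sub, sum_sub_distrib]
      rw [← sum_mul, h0]; simp
    rw [this]
    apply sum_congr rfl
    intro c _
    rw [sum_congr rfl (g := fun _ => ψ c)]
    · rw [sum_const, nsmul_eq_mul, filter_filter, mul_comm]
    · intro x hx
      rw [(mem_filter.1 hx).2]
  rw [hmain]
  refine (norm_sum_le _ _).trans ?_
  refine (sum_le_card_nsmul univ _ (6 * q * (q:ℝ) ^ (m+1)) ?_).trans ?_
  · intro c _
    rw [norm_mul, AddChar.norm_apply, one_mul, Complex.norm_real]
    exact habs c
  · rw [card_univ, ← hqdef, nsmul_eq_mul]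
    apply le_of_eq; ring

theorem ks_two {k E : Type} [Field k] [Fintype k] [Field E] [Fintype E] [DecidableEq k] [DecidableEq E]
    [Algebra k E] (hfin : Module.finrank k E = 2) (hodd : ringChar k ≠ 2) (s n : k) :
    (univ.filter (fun x : E => Algebra.trace k E x = s ∧ Algebra.norm k x = n)).card +
    (univ.filter (fun p : k × k => p.1 + p.2 = s ∧ p.1 * p.2 = n)).card = 2 := by
  set q := Fintype.card k with hq
  have h2 : (2 : k) ≠ 0 := Ring.two_ne_zero hodd
  have h2E : (2 : E) ≠ 0 := by
    have := (map_ne_zero (algebraMap k E)).2 h2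
    rwa [map_ofNat] at this
  have hinj := (algebraMap k E).injective
  have htr : ∀ x : E, algebraMap k E (Algebra.trace k E x) = x + x ^ q := by
    intro x
    rw [FiniteField.algebraMap_trace_eq_sum_pow, hfin]
    simp [sum_range_succ, hq]
  have hA : ∀ x : E, (Algebra.trace k E x = s ∧ Algebra.norm k x = n) ↔
      (x + x ^ q = algebraMap k E s ∧ x * x ^ q = algebraMap k E n) := by
    intro x
    rw [← hinj.eq_iff, ← hinj.eq_iff (a := Algebra.norm k x), htr,
      FiniteField.algebraMap_norm_eq_prod_pow, hfin]
    simp [prod_range_succ, hq]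
  simp only [hA]
  have hfr : ∀ a : k, (algebraMap k E a) ^ q = algebraMap k E a := by
    intro a; rw [← map_pow, hq, FiniteField.pow_card]
  have hfadd : ∀ x y : E, (x + y) ^ q = x ^ q + y ^ q := fun x y =>
    map_add (FiniteField.frobeniusAlgHom k E) x y
  have hqodd : q % 2 = 1 := FiniteField.odd_card_of_char_ne_two hodd
  have hsqx : ∀ x : E, x + x ^ q = algebraMap k E s → x * x ^ q = algebraMap k E n →
      (2 * x - algebraMap k E s) ^ 2 = algebraMap k E (s ^ 2 - 4 * n) := by
    intro x h h'
    simp only [map_sub, map_mul, map_pow, map_ofNat]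
    rw [← h, ← h']; ring
  by_cases hsq : IsSquare (s ^ 2 - 4 * n)
  · obtain ⟨w, hw⟩ := hsq
    have hB : (univ.filter (fun p : k × k => p.1 + p.2 = s ∧ p.1 * p.2 = n)) =
        {((s + w) / 2, (s - w) / 2), ((s - w) / 2, (s + w) / 2)} := by
      ext ⟨u, v⟩
      simp only [mem_filter, mem_univ, true_and, mem_insert, mem_singleton, Prod.mk.injEq]
      constructor
      · rintro ⟨h, h'⟩
        have : (u - v - w) * (u - v + w) = 0 := by
          rw [← h, ← h'] at hw
          linear_combination hw
        rcases mul_eq_zero.1 this with h3 | h3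
        · left; constructor <;> field_simp
          · linear_combination h + h3
          · linear_combination h - h3
        · right; constructor <;> field_simp
          · linear_combination h + h3
          · linear_combination h - h3
      · have h4 : (4 : k) ≠ 0 := by
          have : (4 : k) = 2 * 2 := by norm_num
          rw [this]; exact mul_ne_zero h2 h2
        have hp : (s + w) / 2 * ((s - w) / 2) = n := by
          rw [div_mul_div_comm, div_eq_iff (mul_ne_zero h2 h2)]
          linear_combination hw
        have hs : (s + w) / 2 + (s - w) / 2 = s := by
          rw [← add_div, div_eq_iff h2]; ring
        rintro (⟨rfl, rfl⟩ | ⟨rfl, rfl⟩)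
        · exact ⟨hs, hp⟩
        · exact ⟨by rw [add_comm]; exact hs, by rw [mul_comm]; exact hp⟩
    by_cases hw0 : w = 0
    · subst hw0
      have hA' : (univ.filter (fun x : E => x + x ^ q = algebraMap k E s ∧ x * x ^ q = algebraMap k E n)) =
          {algebraMap k E (s / 2)} := by
        ext x
        simp only [mem_filter, mem_univ, true_and, mem_singleton]
        constructor
        · rintro ⟨h, h'⟩
          have := hsqx x h h'
          rw [hw, mul_zero, map_zero, pow_eq_zero_iff two_ne_zero] at this
          rw [map_div₀, map_ofNat]
          field_simp
          linear_combination this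
        · rintro rfl
          rw [hfr]
          rw [← map_add, ← map_mul]
          constructor
          · congr 1; field_simp; ring
          · congr 1
            rw [div_mul_div_comm, div_eq_iff (mul_ne_zero h2 h2)]
            linear_combination hw
      rw [hA', hB]; simp
    · have hA' : (univ.filter (fun x : E => x + x ^ q = algebraMap k E s ∧ x * x ^ q = algebraMap k E n)) = ∅ := by
        rw [filter_eq_empty_iff]
        rintro x - ⟨h, h'⟩
        have e := hsqx x h h'
        have hx : ∃ a : k, x = algebraMap k E a := by
          rw [hw, map_mul] at e
          have : (2 * x - algebraMap k E s - algebraMap k E w) * (2 * x - algebraMap k E s + algebraMap k E w) = 0 := by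
            linear_combination e
          rcases mul_eq_zero.1 this with h3 | h3
          · refine ⟨(s + w) / 2, ?_⟩
            rw [map_div₀, map_ofNat, map_add]; field_simp; linear_combination h3
          · refine ⟨(s - w) / 2, ?_⟩
            rw [map_div₀, map_ofNat, map_sub]; field_simp; linear_combination h3
        obtain ⟨a, rfl⟩ := hx
        rw [hfr] at h
        have : 2 * algebraMap k E a - algebraMap k E s = 0 := by rw [← h]; ring
        rw [this, hw] at e
        have e2 := (map_eq_zero (algebraMap k E)).1 (by rw [← e]; simp : algebraMap k E (w * w) = 0)
        exact hw0 (by simpa using e2)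
      rw [hA', hB, card_pair]
      · simp
      · intro h
        have h1 := (Prod.mk.inj h).1
        rw [div_left_inj' h2] at h1
        have : 2 * w = 0 := by linear_combination h1
        rcases mul_eq_zero.1 this with h | h
        · exact h2 h
        · exact hw0 h
  · have hd0 : s ^ 2 - 4 * n ≠ 0 := by
      intro h; rw [h] at hsq; exact hsq (IsSquare.zero)
    have hB : (univ.filter (fun p : k × k => p.1 + p.2 = s ∧ p.1 * p.2 = n)) = ∅ := by
      rw [filter_eq_empty_iff]
      rintro ⟨u, v⟩ - ⟨h, h'⟩
      simp only at h h'
      apply hsq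
      refine ⟨u - v, ?_⟩
      rw [← h, ← h']; ring
    have hcE : Fintype.card E = q ^ 2 := by
      rw [Module.card_eq_pow_finrank (K := k), hfin]
    have hsE : IsSquare (algebraMap k E (s ^ 2 - 4 * n)) := by
      have hrE : ringChar E ≠ 2 := by
        intro h
        have := FiniteField.even_card_of_char_two h
        rw [hcE, Nat.pow_mod, hqodd] at this
        simp at this
      rw [FiniteField.isSquare_iff hrE ((map_ne_zero (algebraMap k E)).2 hd0)]
      obtain ⟨r, hr⟩ : ∃ r, q = 2 * r + 1 := ⟨q / 2, by omega⟩
      have e1 : Fintype.card E / 2 = (q - 1) * (r + 1) := by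
        rw [hcE, hr]
        have : (2 * r + 1) ^ 2 = 2 * (2 * r * (r + 1)) + 1 := by ring
        rw [this]
        simp only [Nat.add_sub_cancel]
        omega
      rw [e1, pow_mul, ← map_pow, FiniteField.pow_card_sub_one_eq_one _ hd0]
      simp
    obtain ⟨δ, hδ⟩ := hsE
    have hδ0 : δ ≠ 0 := by
      rintro rfl
      rw [mul_zero, map_eq_zero] at hδ
      exact hd0 hδ
    have hδq : δ ^ q = - δ := by
      have : (δ ^ q - δ) * (δ ^ q + δ) = 0 := by
        have := hfr (s ^ 2 - 4 * n)
        rw [hδ, mul_pow] at this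
        linear_combination this
      rcases mul_eq_zero.1 this with h3 | h3
      · exfalso
        have h4 := htr δ
        have h5 : δ = algebraMap k E (Algebra.trace k E δ / 2) := by
          rw [map_div₀, map_ofNat, h4]; field_simp; linear_combination -h3
        apply hsq
        refine ⟨Algebra.trace k E δ / 2, ?_⟩
        apply hinj
        rw [map_mul, ← h5, hδ]
      · linear_combination h3
    have h2q : (2 : E) ^ q = 2 := by
      have := hfr 2
      rwa [map_ofNat] at this
    have hodd' : Odd q := Nat.odd_iff.2 hqodd
    have hA' : (univ.filter (fun x : E => x + x ^ q = algebraMap k E s ∧ x * x ^ q = algebraMap k E n)) =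
        {(algebraMap k E s + δ) / 2, (algebraMap k E s + -δ) / 2} := by
      ext x
      simp only [mem_filter, mem_univ, true_and, mem_singleton, mem_insert]
      constructor
      · rintro ⟨h, h'⟩
        have e := hsqx x h h'
        rw [hδ] at e
        have : (2 * x - algebraMap k E s - δ) * (2 * x - algebraMap k E s + δ) = 0 := by
          linear_combination e
        rcases mul_eq_zero.1 this with h3 | h3
        · left; field_simp; linear_combination h3
        · right; field_simp; linear_combination h3
      · have e2 : algebraMap k E s ^ 2 - 4 * algebraMap k E n = δ * δ := by
          rw [← hδ]; simp only [map_sub, map_mul, map_pow, map_ofNat]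
        have hs : (algebraMap k E s + δ) / 2 + (algebraMap k E s + -δ) / 2 = algebraMap k E s := by
          field_simp; ring
        have hp : (algebraMap k E s + δ) / 2 * ((algebraMap k E s + -δ) / 2) = algebraMap k E n := by
          rw [div_mul_div_comm, div_eq_iff (mul_ne_zero h2E h2E)]
          linear_combination e2
        have f1 : ((algebraMap k E s + δ) / 2) ^ q = (algebraMap k E s + -δ) / 2 := by
          rw [div_pow, hfadd, hfr, h2q, hδq]
        have f2 : ((algebraMap k E s + -δ) / 2) ^ q = (algebraMap k E s + δ) / 2 := by
          rw [div_pow, hfadd, hfr, h2q, hodd'.neg_pow, hδq, neg_neg]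
        rintro (rfl | rfl)
        · rw [f1]; exact ⟨hs, hp⟩
        · rw [f2]; exact ⟨by rw [add_comm]; exact hs, by rw [mul_comm]; exact hp⟩
    rw [hA', hB, card_pair]
    · simp
    · intro h
      rw [div_left_inj' h2E] at h
      have : 2 * δ = 0 := by linear_combination h
      rcases mul_eq_zero.1 this with h | h
      · exact h2E h
      · exact hδ0 h

theorem ks_quad {k E : Type} [Field k] [Fintype k] [Field E] [Fintype E] [DecidableEq k] [DecidableEq E]
    [Algebra k E] (hfin : Module.finrank k E = 2) (hodd : ringChar k ≠ 2) (ψ : AddChar k ℂ)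
    (hψ : ψ ≠ 1) (b : k) (hb : b ≠ 0) :
    ∑ x ∈ univ.filter (fun x : E => x ≠ 0), ψ (Algebra.trace k E (x + algebraMap k E b * x⁻¹)) =
    2 * (Fintype.card k : ℂ) - (∑ x ∈ univ.filter (fun x : k => x ≠ 0), ψ (x + b * x⁻¹)) ^ 2 := by
  have hinj := (algebraMap k E).injective
  have htr : ∀ x : E, algebraMap k E (Algebra.trace k E x) = x + x ^ Fintype.card k := by
    intro x
    rw [FiniteField.algebraMap_trace_eq_sum_pow, hfin]
    simp [sum_range_succ]
  have hnm : ∀ x : E, algebraMap k E (Algebra.norm k x) = x * x ^ Fintype.card k := by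
    intro x
    rw [FiniteField.algebraMap_norm_eq_prod_pow, hfin]
    simp [prod_range_succ]
  have htinv : ∀ x : E, x ≠ 0 → Algebra.trace k E (x + algebraMap k E b * x⁻¹) =
      Algebra.trace k E x + b * (Algebra.trace k E x / Algebra.norm k x) := by
    intro x hx
    rw [map_add, ← Algebra.smul_def, map_smul, smul_eq_mul]
    congr 2
    apply hinj
    rw [map_div₀, htr, htr, hnm, inv_pow]
    have : x ^ Fintype.card k ≠ 0 := pow_ne_zero _ hx
    field_simp
    ring
  let f : k × k → ℂ := fun p => ψ (p.1 + b * (p.1 / p.2))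
  have h1 : ∑ x ∈ univ.filter (fun x : E => x ≠ 0), ψ (Algebra.trace k E (x + algebraMap k E b * x⁻¹)) =
      ∑ p ∈ univ.filter (fun p : k × k => p.2 ≠ 0),
        ((univ.filter (fun x : E => Algebra.trace k E x = p.1 ∧ Algebra.norm k x = p.2)).card : ℂ) * f p := by
    rw [← sum_fiberwise_of_maps_to (g := fun x : E => (Algebra.trace k E x, Algebra.norm k x))
      (t := univ.filter (fun p : k × k => p.2 ≠ 0))]
    · apply sum_congr rfl
      rintro ⟨s, n⟩ hp
      simp only [mem_filter, mem_univ, true_and] at hp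
      rw [← nsmul_eq_mul, ← sum_const]
      apply sum_congr
      · ext x
        simp only [mem_filter, mem_univ, true_and, Prod.mk.injEq]
        constructor
        · rintro ⟨_, h⟩; exact h
        · rintro h
          refine ⟨?_, h⟩
          rintro rfl
          apply hp
          rw [← h.2, Algebra.norm_zero]
      · intro x hx
        simp only [mem_filter, mem_univ, true_and] at hx
        have hx0 : x ≠ 0 := by
          rintro rfl
          apply hp
          rw [← hx.2, Algebra.norm_zero]
        rw [htinv x hx0, hx.1, hx.2]
    · intro x hx
      simp only [mem_filter, mem_univ, true_and] at hx ⊢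
      exact Algebra.norm_ne_zero_iff.2 hx
  have h2 : (∑ x ∈ univ.filter (fun x : k => x ≠ 0), ψ (x + b * x⁻¹)) ^ 2 =
      ∑ p ∈ univ.filter (fun p : k × k => p.2 ≠ 0),
        ((univ.filter (fun r : k × k => r.1 + r.2 = p.1 ∧ r.1 * r.2 = p.2)).card : ℂ) * f p := by
    rw [sq, sum_mul_sum, ← sum_product',
      ← sum_fiberwise_of_maps_to (g := fun r : k × k => (r.1 + r.2, r.1 * r.2))
      (t := univ.filter (fun p : k × k => p.2 ≠ 0))]
    · apply sum_congr rfl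
      rintro ⟨s, n⟩ hp
      simp only [mem_filter, mem_univ, true_and] at hp
      rw [← nsmul_eq_mul, ← sum_const]
      apply sum_congr
      · ext ⟨u, v⟩
        simp only [mem_filter, mem_univ, true_and, Prod.mk.injEq, mem_product]
        constructor
        · rintro ⟨_, h⟩; exact h
        · rintro h
          refine ⟨?_, h⟩
          rw [← h.2] at hp
          exact ⟨left_ne_zero_of_mul hp, right_ne_zero_of_mul hp⟩
      · rintro ⟨u, v⟩ hx
        simp only [mem_filter, mem_univ, true_and] at hx
        rw [← hx.2] at hp
        have hu := left_ne_zero_of_mul hp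
        have hv := right_ne_zero_of_mul hp
        rw [← AddChar.map_add_eq_mul]
        simp only [f]
        rw [← hx.1, ← hx.2]
        congr 1
        field_simp
        ring
    · intro x hx
      simp only [mem_filter, mem_univ, true_and, mem_product] at hx ⊢
      exact mul_ne_zero hx.1 hx.2
  rw [eq_sub_iff_add_eq, h1, h2, ← sum_add_distrib]
  have h3 : ∀ p : k × k, ((univ.filter (fun x : E => Algebra.trace k E x = p.1 ∧ Algebra.norm k x = p.2)).card : ℂ) * f p +
     ((univ.filter (fun r : k × k => r.1 + r.2 = p.1 ∧ r.1 * r.2 = p.2)).card : ℂ) * f p = 2 * f p := by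
    intro p
    rw [← add_mul, ← Nat.cast_add, ks_two hfin hodd]
    norm_num
  simp only [h3]
  rw [← mul_sum]
  congr 1
  have h4 : univ.filter (fun p : k × k => p.2 ≠ 0) = (univ : Finset k) ×ˢ (univ.filter (fun n : k => n ≠ 0)) := by
    ext ⟨s, n⟩; simp
  rw [h4, sum_product_right]
  have h5 : ∀ n : k, ∑ s : k, f (s, n) = if 1 + b / n = 0 then (Fintype.card k : ℂ) else 0 := by
    intro n
    have := AddChar.sum_mulShift (1 + b / n) (AddChar.IsPrimitive.of_ne_one hψ)
    push_cast at this
    rw [← this]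
    apply sum_congr rfl
    intro s _
    simp only [f]
    congr 1
    ring
  simp only [h5]
  rw [sum_eq_single (-b)]
  · rw [div_neg, div_self hb]; simp
  · intro n hn hne
    simp only [mem_filter, mem_univ, true_and] at hn
    rw [if_neg]
    intro h
    apply hne
    field_simp at h
    linear_combination h
  · intro h
    exact absurd hb (by simpa using h)

noncomputable def ksT (q : ℕ) (K : ℂ) : ℕ → ℂ
  | 0 => K
  | (j + 1) => 2 * (q : ℂ) ^ (2 ^ j) - (ksT q K j) ^ 2

theorem ks_tower {F : Type} [Field F] [Fintype F] [DecidableEq F] (hodd : ringChar F ≠ 2) (ψ : AddChar F ℂ)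
    (hψ : ψ ≠ 1) (b : F) (hb : b ≠ 0) (j : ℕ) :
    ∃ (E : Type) (_ : Field E) (_ : Fintype E) (_ : DecidableEq E) (_ : Algebra F E),
      Module.finrank F E = 2 ^ j ∧
      ∑ x ∈ univ.filter (fun x : E => x ≠ 0), ψ (Algebra.trace F E (x + algebraMap F E b * x⁻¹)) =
        ksT (Fintype.card F) (∑ x ∈ univ.filter (fun x : F => x ≠ 0), ψ (x + b * x⁻¹)) j := by
  induction j with
  | zero =>
    refine ⟨F, inferInstance, inferInstance, inferInstance, inferInstance, by simp, ?_⟩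
    simp [ksT, Algebra.trace_self_apply]
  | succ j ih =>
    obtain ⟨E, iE, iF, iD, iA, hfr, hs⟩ := ih
    obtain ⟨p, hp⟩ := CharP.exists E
    haveI : Fact p.Prime := ⟨CharP.char_is_prime E p⟩
    letI := Fintype.ofFinite (FiniteField.Extension E p 2)
    letI : DecidableEq (FiniteField.Extension E p 2) := Classical.decEq _
    letI iA2 : Algebra F (FiniteField.Extension E p 2) :=
      ((algebraMap E (FiniteField.Extension E p 2)).comp (algebraMap F E)).toAlgebra
    haveI : IsScalarTower F E (FiniteField.Extension E p 2) := IsScalarTower.of_algebraMap_eq (fun x => rfl)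
    have hE2 : Module.finrank E (FiniteField.Extension E p 2) = 2 := FiniteField.finrank_extension E p 2
    refine ⟨FiniteField.Extension E p 2, inferInstance, inferInstance, inferInstance, iA2, ?_, ?_⟩
    · rw [← Module.finrank_mul_finrank F E, hfr, hE2, pow_succ]
    · let χ : AddChar E ℂ := ψ.compAddMonoidHom (Algebra.trace F E).toAddMonoidHom
      have hχa : ∀ x, χ x = ψ (Algebra.trace F E x) := fun x => rfl
      have hχ : χ ≠ 1 := by
        intro h
        apply hψ
        ext y
        obtain ⟨x, rfl⟩ := Algebra.trace_surjective F E y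
        rw [← hχa, h]; rfl
      have hodd' : ringChar E ≠ 2 := by
        rwa [← Algebra.ringChar_eq F E]
      have hq := ks_quad (E := FiniteField.Extension E p 2) hE2 hodd' χ hχ (algebraMap F E b)
        ((map_ne_zero _).2 hb)
      simp only [hχa, Algebra.trace_trace, ← IsScalarTower.algebraMap_apply] at hq
      rw [hq, hs, ksT, Module.card_eq_pow_finrank (K := F), hfr]
      push_cast
      rfl

theorem ks_weil {F : Type} [Field F] [Fintype F] [DecidableEq F] (hodd : ringChar F ≠ 2) (ψ : AddChar F ℂ)
    (hψ : ψ ≠ 1) (b : F) (hb : b ≠ 0) :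
    ‖∑ x ∈ univ.filter (fun x : F => x ≠ 0), ψ (x + b * x⁻¹)‖ ≤ 2 * √(Fintype.card F : ℝ) := by
  set K := ∑ x ∈ univ.filter (fun x : F => x ≠ 0), ψ (x + b * x⁻¹) with hK
  have hq1 : 1 < Fintype.card F := Fintype.one_lt_card
  have hq2 := FiniteField.odd_card_of_char_ne_two hodd
  have hq3 : 3 ≤ Fintype.card F := by omega
  set r := √(Fintype.card F : ℝ) with hr
  have hr2 : r ^ 2 = (Fintype.card F : ℝ) := Real.sq_sqrt (by positivity)
  have hr0 : 0 < r := Real.sqrt_pos.2 (by positivity)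
  by_contra hcon
  push Not at hcon
  obtain ⟨ε, hε, hKε⟩ : ∃ ε : ℝ, 0 < ε ∧ ‖K‖ = (2 + ε) * r := by
    refine ⟨‖K‖ / r - 2, ?_, ?_⟩
    · rw [sub_pos, lt_div_iff₀ hr0]; exact hcon
    · field_simp; ring
  have hlow : ∀ j, (2 + 4 ^ j * ε) * r ^ (2 ^ j) ≤ ‖ksT (Fintype.card F) K j‖ := by
    intro j
    induction j with
    | zero => simp [ksT, hKε]
    | succ j ih =>
      have h1 : ‖(ksT (Fintype.card F) K j) ^ 2‖ - ‖2 * (Fintype.card F : ℂ) ^ (2 ^ j)‖ ≤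
          ‖ksT (Fintype.card F) K (j + 1)‖ := by
        rw [ksT, norm_sub_rev]; exact norm_sub_norm_le _ _
      refine le_trans ?_ h1
      rw [norm_pow, norm_mul, norm_pow, Complex.norm_natCast, ← hr2, Complex.norm_ofNat]
      have h2 : ((2 + 4 ^ j * ε) * r ^ (2 ^ j)) ^ 2 ≤ ‖ksT (Fintype.card F) K j‖ ^ 2 :=
        pow_le_pow_left₀ (by positivity) ih 2
      have h3 : (r ^ 2) ^ (2 ^ j) = (r ^ (2 ^ j)) ^ 2 := by rw [← pow_mul, ← pow_mul, mul_comm]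
      have h4 : r ^ (2 ^ (j + 1)) = (r ^ (2 ^ j)) ^ 2 := by rw [← pow_mul, pow_succ]
      rw [h3, h4, pow_succ]
      have h5 : 0 ≤ (4 ^ j * ε * r ^ (2 ^ j)) ^ 2 := sq_nonneg _
      nlinarith
  have hup : ∀ j, ‖ksT (Fintype.card F) K (j + 1)‖ ≤ 6 * (Fintype.card F : ℝ) ^ 2 * r ^ (2 ^ (j + 1)) := by
    intro j
    obtain ⟨E, iE, iF, iD, iA, hfr, hs⟩ := ks_tower hodd ψ hψ b hb (j + 1)
    have hj : 1 ≤ 2 ^ j := Nat.one_le_two_pow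
    have := ks_rough (E := E) b ψ hψ hq3 (2 ^ j - 1) (by rw [hfr, Nat.sub_add_cancel hj, pow_succ, mul_comm])
    rw [hs, Nat.sub_add_cancel hj] at this
    refine this.trans (le_of_eq ?_)
    have h4 : r ^ (2 ^ (j + 1)) = (r ^ 2) ^ (2 ^ j) := by rw [← pow_mul, pow_succ, mul_comm]
    rw [h4, hr2]
  obtain ⟨j, hj⟩ := pow_unbounded_of_one_lt (6 * (Fintype.card F : ℝ) ^ 2 / ε) (by norm_num : (1 : ℝ) < 4)
  have h1 := (hlow (j + 1)).trans (hup j)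
  have h2 := le_of_mul_le_mul_right h1 (by positivity)
  rw [div_lt_iff₀ hε] at hj
  have h3 : 0 < (4 : ℝ) ^ j * ε := by positivity
  rw [pow_succ] at h2
  nlinarith

theorem ks_gauss {F : Type} [Field F] [Fintype F] [DecidableEq F] (hodd : ringChar F ≠ 2) (ψ : AddChar F ℂ)
    (hψ : ψ ≠ 1) : ∃ ε : ℂ, ‖ε‖ = 1 ∧ ∀ a : F, a ≠ 0 →
      (∑ x : F, ψ (a * x ^ 2)) ^ 2 = ε * (Fintype.card F : ℂ) := by
  set η : MulChar F ℂ := (quadraticChar F).ringHomComp (Int.castRingHom ℂ) with hη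
  refine ⟨η (-1), ?_, ?_⟩
  · rw [hη, MulChar.ringHomComp_apply]
    rcases quadraticChar_dichotomy (F := F) (a := -1) (by simp) with h | h <;> rw [h] <;> simp
  · intro a ha
    have hprim : (AddChar.mulShift ψ a).IsPrimitive := by
      apply AddChar.IsPrimitive.of_ne_one
      exact (AddChar.IsPrimitive.of_ne_one hψ) ha
    have h1 : ∑ x : F, ψ (a * x ^ 2) = gaussSum η (AddChar.mulShift ψ a) := by
      rw [← sum_fiberwise (s := (univ : Finset F)) (g := fun x : F => x ^ 2)]
      have h2 : ∀ y : F, ∑ x ∈ univ.filter (fun x : F => x ^ 2 = y), ψ (a * x ^ 2) =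
          η y * ψ (a * y) + ψ (a * y) := by
        intro y
        have : ∀ x ∈ univ.filter (fun x : F => x ^ 2 = y), ψ (a * x ^ 2) = ψ (a * y) := by
          intro x hx
          rw [(mem_filter.1 hx).2]
        rw [sum_congr rfl this, sum_const, nsmul_eq_mul]
        have hc := quadraticChar_card_sqrts hodd y
        have hc2 : (univ.filter (fun x : F => x ^ 2 = y)) = {x : F | x ^ 2 = y}.toFinset := by
          ext; simp
        rw [hc2]
        have hc3 := congrArg (Int.cast : ℤ → ℂ) hc
        push_cast at hc3
        rw [hc3, hη, MulChar.ringHomComp_apply]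
        simp only [eq_intCast]
        ring
      simp only [h2]
      rw [sum_add_distrib]
      have h3 : ∑ y : F, ψ (a * y) = 0 := by
        have := AddChar.sum_mulShift a (AddChar.IsPrimitive.of_ne_one hψ)
        rw [if_neg ha] at this
        rw [← Nat.cast_zero, ← this]
        apply sum_congr rfl
        intro y _; rw [mul_comm]
      rw [h3, add_zero]
      rfl
    rw [h1, gaussSum_sq _ _ hprim]
    · exact (MulChar.ringHomComp_ne_one_iff (RingHom.injective_int _)).2 (quadraticChar_ne_one hodd)
    · exact (quadraticChar_isQuadratic F).comp _

theorem ks_orth {F : Type} [Field F] [Fintype F] [DecidableEq F] (ψ : AddChar F ℂ)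
    (hψ : ψ ≠ 1) (w : F × F) :
    ∑ ξ : F × F, ψ (ξ.1 * w.1 + ξ.2 * w.2) = if w = 0 then (Fintype.card F : ℂ) ^ 2 else 0 := by
  have hp := AddChar.IsPrimitive.of_ne_one hψ
  rw [Fintype.sum_prod_type]
  simp only [AddChar.map_add_eq_mul]
  simp only [← mul_sum, ← sum_mul]
  rw [AddChar.sum_mulShift w.1 hp, AddChar.sum_mulShift w.2 hp]
  by_cases h1 : w.1 = 0 <;> by_cases h2 : w.2 = 0 <;> simp [h1, h2, Prod.ext_iff, sq]

theorem ks_parseval {F : Type} [Field F] [Fintype F] [DecidableEq F] (ψ : AddChar F ℂ)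
    (hψ : ψ ≠ 1) (X : Finset (F × F)) :
    ∑ ξ : F × F, ‖∑ u ∈ X, ψ (ξ.1 * u.1 + ξ.2 * u.2)‖ ^ 2 = (Fintype.card F : ℝ) ^ 2 * X.card := by
  have h : ∀ ξ : F × F, ((‖∑ u ∈ X, ψ (ξ.1 * u.1 + ξ.2 * u.2)‖ ^ 2 : ℝ) : ℂ) =
      ∑ u ∈ X, ∑ v ∈ X, ψ (ξ.1 * (u - v).1 + ξ.2 * (u - v).2) := by
    intro ξ
    push_cast
    rw [← Complex.mul_conj', map_sum, sum_mul_sum]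
    apply sum_congr rfl; intro u _
    apply sum_congr rfl; intro v _
    rw [← AddChar.map_neg_eq_conj, ← AddChar.map_add_eq_mul]
    congr 1
    simp only [Prod.fst_sub, Prod.snd_sub]; ring
  have : ((∑ ξ : F × F, ‖∑ u ∈ X, ψ (ξ.1 * u.1 + ξ.2 * u.2)‖ ^ 2 : ℝ) : ℂ) =
     (((Fintype.card F : ℝ) ^ 2 * X.card : ℝ) : ℂ) := by
    rw [Complex.ofReal_sum]
    simp only [h]
    rw [sum_comm]
    have h2 : ∀ u ∈ X, ∑ ξ : F × F, ∑ v ∈ X, ψ (ξ.1 * (u - v).1 + ξ.2 * (u - v).2) =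
        (Fintype.card F : ℂ) ^ 2 := by
      intro u hu
      rw [sum_comm]
      simp only [ks_orth ψ hψ, sub_eq_zero]
      rw [sum_ite_eq, if_pos hu]
    rw [sum_congr rfl h2, sum_const, nsmul_eq_mul]
    push_cast
    ring
  exact_mod_cast this

/-- the Kloosterman-type coefficient -/
noncomputable def ksK {F : Type} [Field F] [Fintype F] [DecidableEq F] (ψ : AddChar F ℂ) (t a : F) : ℂ :=
  ∑ s ∈ univ.filter (fun s : F => s ≠ 0), ψ (-(s * t) - a / (4 * s))

theorem ksK_zero {F : Type} [Field F] [Fintype F] [DecidableEq F] (ψ : AddChar F ℂ) (hψ : ψ ≠ 1)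
    (t : F) (ht : t ≠ 0) : ksK ψ t 0 = -1 := by
  have := AddChar.sum_mulShift (-t) (AddChar.IsPrimitive.of_ne_one hψ)
  rw [if_neg (neg_ne_zero.2 ht), ← sum_filter_add_sum_filter_not univ (fun s : F => s ≠ 0)] at this
  have h0 : univ.filter (fun s : F => ¬ s ≠ 0) = {0} := by ext; simp
  rw [h0] at this
  simp only [sum_singleton, zero_mul, AddChar.map_zero_eq_one, Nat.cast_zero] at this
  rw [ksK, eq_neg_iff_add_eq_zero, ← this]
  congr 1
  apply sum_congr rfl; intro s _
  congr 1; simp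

theorem ksK_bound {F : Type} [Field F] [Fintype F] [DecidableEq F] (hodd : ringChar F ≠ 2)
    (ψ : AddChar F ℂ) (hψ : ψ ≠ 1)
    (t : F) (ht : t ≠ 0) (a : F) : ‖ksK ψ t a‖ ≤ 2 * √(Fintype.card F : ℝ) := by
  by_cases ha : a = 0
  · rw [ha, ksK_zero ψ hψ t ht, norm_neg, norm_one]
    have : (1 : ℝ) ≤ √(Fintype.card F : ℝ) := by
      rw [Real.one_le_sqrt]
      exact_mod_cast Fintype.card_pos
    linarith
  · have h2 : (2 : F) ≠ 0 := Ring.two_ne_zero hodd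
    have h4 : (4 : F) ≠ 0 := by
      have : (4 : F) = 2 * 2 := by norm_num
      rw [this]; exact mul_ne_zero h2 h2
    have := ks_weil hodd ψ hψ (t * a / 4) (div_ne_zero (mul_ne_zero ht ha) h4)
    refine le_trans (le_of_eq ?_) this
    congr 1
    rw [ksK]
    apply sum_bij' (fun s _ => -(s * t)) (fun s _ => -(s / t))
    · intro s hs; simp only [mem_filter, mem_univ, true_and] at hs ⊢; simp [hs, ht]
    · intro s hs; simp only [mem_filter, mem_univ, true_and] at hs ⊢; simp [hs, ht]
    · intro s hs; field_simp
    · intro s hs; field_simp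
    · intro s hs
      simp only [mem_filter, mem_univ, true_and] at hs
      congr 1
      field_simp
      try ring

theorem ks_ind {F : Type} [Field F] [Fintype F] [DecidableEq F] (hodd : ringChar F ≠ 2)
    (ψ : AddChar F ℂ) (hψ : ψ ≠ 1) (t : F) :
    ∃ ε : ℂ, ‖ε‖ = 1 ∧ ∀ w : F × F, (Fintype.card F : ℂ) ^ 2 * (if nrm w = t then (1 : ℂ) else 0) =
      (Fintype.card F : ℂ) + ε * ∑ ξ : F × F, ksK ψ t (nrm ξ) * ψ (ξ.1 * w.1 + ξ.2 * w.2) := by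
  obtain ⟨δ, hδ, hg⟩ := ks_gauss hodd ψ hψ
  have hδ0 : δ ≠ 0 := by rintro rfl; simp at hδ
  have h2 : (2 : F) ≠ 0 := Ring.two_ne_zero hodd
  have h4 : (4 : F) ≠ 0 := by
    have : (4 : F) = 2 * 2 := by norm_num
    rw [this]; exact mul_ne_zero h2 h2
  refine ⟨δ⁻¹, by rw [norm_inv, hδ, inv_one], ?_⟩
  intro w
  have h5 : ∀ s : F, s ≠ 0 → ∑ ξ : F × F, ψ (-(nrm ξ) / (4 * s)) * ψ (ξ.1 * w.1 + ξ.2 * w.2) =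
      δ * (Fintype.card F : ℂ) * ψ (s * nrm w) := by
    intro s hs
    have hc : ∀ z : F, ∑ x : F, ψ (-(1 / (4 * s)) * (x - 2 * s * z) ^ 2) = ∑ x : F, ψ (-(1 / (4 * s)) * x ^ 2) := by
      intro z
      exact Fintype.sum_equiv (Equiv.subRight (2 * s * z)) _ _ (fun x => rfl)
    have hcc : (∑ x : F, ψ (-(1 / (4 * s)) * x ^ 2)) ^ 2 =
        (∑ x : F, ψ (-(1 / (4 * s)) * (x - 2 * s * w.1) ^ 2)) *
        (∑ x : F, ψ (-(1 / (4 * s)) * (x - 2 * s * w.2) ^ 2)) := by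
      rw [hc, hc, sq]
    rw [← hg (-(1 / (4 * s))) (by simp [h4, hs]), hcc]
    rw [sum_mul_sum, sum_mul, Fintype.sum_prod_type]
    apply sum_congr rfl; intro x _
    rw [sum_mul]
    apply sum_congr rfl; intro y _
    rw [← AddChar.map_add_eq_mul, ← AddChar.map_add_eq_mul, ← AddChar.map_add_eq_mul]
    congr 1
    simp only [nrm]
    field_simp
    ring
  have h6 : ∑ ξ : F × F, ksK ψ t (nrm ξ) * ψ (ξ.1 * w.1 + ξ.2 * w.2) =
      δ * (Fintype.card F : ℂ) * ∑ s ∈ univ.filter (fun s : F => s ≠ 0), ψ (s * (nrm w - t)) := by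
    simp only [ksK, sum_mul]
    rw [sum_comm, mul_sum]
    apply sum_congr rfl
    intro s hs
    simp only [mem_filter, mem_univ, true_and] at hs
    have : s * (nrm w - t) = s * nrm w + -(s * t) := by ring
    rw [this, AddChar.map_add_eq_mul, ← mul_assoc, ← h5 s hs, sum_mul]
    apply sum_congr rfl
    intro ξ _
    rw [← AddChar.map_add_eq_mul, ← AddChar.map_add_eq_mul, ← AddChar.map_add_eq_mul]
    congr 1
    ring
  have h7 := AddChar.sum_mulShift (nrm w - t) (AddChar.IsPrimitive.of_ne_one hψ)
  rw [← sum_filter_add_sum_filter_not univ (fun s : F => s ≠ 0)] at h7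
  have h0 : univ.filter (fun s : F => ¬ s ≠ 0) = {0} := by ext; simp
  rw [h0] at h7
  simp only [sum_singleton, zero_mul, AddChar.map_zero_eq_one, sub_eq_zero] at h7
  rw [h6, ← mul_assoc, ← mul_assoc, inv_mul_cancel₀ hδ0, one_mul]
  rw [← eq_sub_iff_add_eq] at h7
  rw [h7]
  split_ifs
  · ring
  · simp

theorem ks_edges {F : Type} [Field F] [Fintype F] [DecidableEq F] (hodd : ringChar F ≠ 2)
    (t : F) (ht : t ≠ 0) (X E : Finset (F × F)) :
    ∃ S : ℝ, 0 ≤ S ∧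
      S ^ 2 ≤ ((Fintype.card F : ℝ) ^ 2 * X.card) * ((Fintype.card F : ℝ) ^ 2 * E.card - (E.card : ℝ) ^ 2) ∧
      (Fintype.card F : ℝ) ^ 2 * ∑ u ∈ X, ((E.filter (fun v => nrm (u - v) = t)).card : ℝ) ≤
        ((Fintype.card F : ℝ) + 1) * (X.card * E.card) + 2 * √(Fintype.card F : ℝ) * S := by
  obtain ⟨ψ, hψ⟩ : ∃ ψ : AddChar F ℂ, ψ ≠ 1 := by
    by_contra h
    push Not at h
    exact one_ne_zero (α := F) (AddChar.forall_apply_eq_zero.1 (fun ψ : AddChar F ℂ => by rw [h ψ]; rfl))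
  obtain ⟨ε, hε, hind⟩ := ks_ind hodd ψ hψ t
  let hat : Finset (F × F) → F × F → ℂ := fun X ξ => ∑ u ∈ X, ψ (ξ.1 * u.1 + ξ.2 * u.2)
  have hpar : ∀ Y : Finset (F × F), ∑ ξ : F × F, ‖hat Y ξ‖ ^ 2 = (Fintype.card F : ℝ) ^ 2 * Y.card :=
    fun Y => ks_parseval ψ hψ Y
  have hat0 : ∀ Y : Finset (F × F), hat Y 0 = Y.card := by
    intro Y; simp [hat]
  have hpar' : ∀ Y : Finset (F × F), ∑ ξ ∈ univ.erase (0 : F × F), ‖hat Y ξ‖ ^ 2 =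
      (Fintype.card F : ℝ) ^ 2 * Y.card - (Y.card : ℝ) ^ 2 := by
    intro Y
    rw [eq_sub_iff_add_eq, ← hpar Y, ← sum_erase_add _ _ (mem_univ (0 : F × F)), hat0]
    simp
  refine ⟨∑ ξ ∈ univ.erase (0 : F × F), ‖hat X ξ‖ * ‖hat E ξ‖, by positivity, ?_, ?_⟩
  · refine (sum_mul_sq_le_sq_mul_sq _ _ _).trans ?_
    rw [hpar', hpar']
    apply mul_le_mul_of_nonneg_right
    · have : (0 : ℝ) ≤ (X.card : ℝ) ^ 2 := by positivity
      linarith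
    · rw [← hpar']; positivity
  · have key : ((Fintype.card F : ℂ) ^ 2 * ∑ u ∈ X, ((E.filter (fun v => nrm (u - v) = t)).card : ℂ)) =
        (Fintype.card F : ℂ) * (X.card * E.card) +
        ε * ∑ ξ : F × F, ksK ψ t (nrm ξ) * (hat X ξ * (starRingEnd ℂ) (hat E ξ)) := by
      have h1 : ∀ u ∈ X, (Fintype.card F : ℂ) ^ 2 * ((E.filter (fun v => nrm (u - v) = t)).card : ℂ) =
          ∑ v ∈ E, ((Fintype.card F : ℂ) + ε * ∑ ξ : F × F, ksK ψ t (nrm ξ) *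
            ψ (ξ.1 * (u - v).1 + ξ.2 * (u - v).2)) := by
        intro u _
        simp only [← hind]
        rw [← mul_sum, card_filter]
        push_cast
        rfl
      rw [mul_sum, sum_congr rfl h1]
      simp only [sum_add_distrib, sum_const, nsmul_eq_mul]
      congr 1
      · ring
      · simp only [← mul_sum]
        congr 1
        have h2 : ∀ u ∈ X, ∑ v ∈ E, ∑ ξ : F × F, ksK ψ t (nrm ξ) * ψ (ξ.1 * (u - v).1 + ξ.2 * (u - v).2) =
            ∑ ξ : F × F, ∑ v ∈ E, ksK ψ t (nrm ξ) * ψ (ξ.1 * (u - v).1 + ξ.2 * (u - v).2) :=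
          fun u _ => sum_comm
        rw [sum_congr rfl h2, sum_comm]
        apply sum_congr rfl
        intro ξ _
        simp only [hat]
        rw [map_sum, sum_mul_sum, mul_sum]
        apply sum_congr rfl; intro u _
        rw [mul_sum]
        apply sum_congr rfl; intro v _
        rw [← AddChar.map_neg_eq_conj, ← AddChar.map_add_eq_mul]
        congr 2
        simp only [Prod.fst_sub, Prod.snd_sub]; ring
    rw [← sum_erase_add _ _ (mem_univ (0 : F × F)), hat0, hat0] at key
    have hn0 : nrm (0 : F × F) = 0 := by simp [nrm]
    rw [hn0, ksK_zero ψ hψ t ht] at key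
    have hnorm := congrArg norm key
    have hL : ‖((Fintype.card F : ℂ) ^ 2 * ∑ u ∈ X, ((E.filter (fun v => nrm (u - v) = t)).card : ℂ))‖ =
        (Fintype.card F : ℝ) ^ 2 * ∑ u ∈ X, ((E.filter (fun v => nrm (u - v) = t)).card : ℝ) := by
      rw [norm_mul, norm_pow, Complex.norm_natCast, ← Nat.cast_sum, Complex.norm_natCast, Nat.cast_sum]
    rw [hL] at hnorm
    rw [hnorm]
    refine (norm_add_le _ _).trans ?_
    rw [norm_mul ε, hε, one_mul]
    have hb1 : ‖(Fintype.card F : ℂ) * (X.card * E.card)‖ = (Fintype.card F : ℝ) * (X.card * E.card) := by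
      simp
    have hb2 : ‖(-1 : ℂ) * ((X.card : ℂ) * (starRingEnd ℂ) (E.card : ℂ))‖ = (X.card : ℝ) * E.card := by
      simp
    have hb3 : ‖∑ ξ ∈ univ.erase (0 : F × F), ksK ψ t (nrm ξ) * (hat X ξ * (starRingEnd ℂ) (hat E ξ))‖ ≤
        2 * √(Fintype.card F : ℝ) * ∑ ξ ∈ univ.erase (0 : F × F), ‖hat X ξ‖ * ‖hat E ξ‖ := by
      refine (norm_sum_le _ _).trans ?_
      rw [mul_sum]
      apply sum_le_sum
      intro ξ _
      rw [norm_mul, norm_mul, RCLike.norm_conj]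
      exact mul_le_mul_of_nonneg_right (ksK_bound hodd ψ hψ t ht _) (by positivity)
    have hb4 := norm_add_le (∑ ξ ∈ univ.erase (0 : F × F), ksK ψ t (nrm ξ) * (hat X ξ * (starRingEnd ℂ) (hat E ξ)))
      ((-1 : ℂ) * ((X.card : ℂ) * (starRingEnd ℂ) (E.card : ℂ)))
    rw [hb1]
    linarith

theorem high_degree_vertices_are_few
    {F : Type} [Field F] [Fintype F] [DecidableEq F]
    (hq : Odd (Fintype.card F)) (t : F) (ht : t ≠ 0)
    (E : Finset (F × F)) (hE : E.Nonempty) :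
    ((E.filter (fun u =>
        2 * (E.card : ℝ) / (Fintype.card F : ℝ) ≤
          ((E.filter (fun v => nrm (u - v) = t)).card : ℝ))).card : ℝ) ≤
      4 * (Fintype.card F : ℝ) ^ 3 / (E.card : ℝ) := by
  have hodd : ringChar F ≠ 2 := by
    intro h
    have := FiniteField.even_card_of_char_two h
    rw [Nat.odd_iff] at hq
    omega
  have hq1 : 1 < Fintype.card F := Fintype.one_lt_card
  set X := E.filter (fun u => 2 * (E.card : ℝ) / (Fintype.card F : ℝ) ≤
          ((E.filter (fun v => nrm (u - v) = t)).card : ℝ)) with hX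
  obtain ⟨S, hS0, hS, he⟩ := ks_edges hodd t ht X E
  have hlow : (X.card : ℝ) * (2 * (E.card : ℝ) / (Fintype.card F : ℝ)) ≤
      ∑ u ∈ X, ((E.filter (fun v => nrm (u - v) = t)).card : ℝ) := by
    rw [← nsmul_eq_mul, ← sum_const]
    apply sum_le_sum
    intro u hu
    exact (mem_filter.1 hu).2
  have hmn : (X.card : ℝ) ≤ E.card := by exact_mod_cast card_filter_le _ _
  have hn : (0 : ℝ) < E.card := by exact_mod_cast hE.card_pos
  have hq1' : (1 : ℝ) < Fintype.card F := by exact_mod_cast hq1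
  rw [le_div_iff₀ hn]
  have hm : (0 : ℝ) ≤ X.card := by positivity
  have hr2 : √(Fintype.card F : ℝ) ^ 2 = (Fintype.card F : ℝ) := Real.sq_sqrt (by positivity)
  have hr0 : 0 ≤ √(Fintype.card F : ℝ) := Real.sqrt_nonneg _
  generalize √(Fintype.card F : ℝ) = r at *
  generalize ∑ u ∈ X, ((E.filter (fun v => nrm (u - v) = t)).card : ℝ) = e at *
  generalize (X.card : ℝ) = m at *
  generalize (E.card : ℝ) = n at *
  generalize (Fintype.card F : ℝ) = q at *
  have hq0 : 0 < q := by linarith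
  by_cases hbig : 2 * q - 1 ≤ n
  · rcases hm.eq_or_lt with h0 | hmp
    · rw [← h0, zero_mul]; positivity
    · have h1 : q ^ 2 * (m * (2 * n / q)) ≤ q ^ 2 * e := mul_le_mul_of_nonneg_left hlow (by positivity)
      have h2 : q ^ 2 * (m * (2 * n / q)) = 2 * q * (m * n) := by field_simp
      have h3 : (q - 1) * (m * n) ≤ 2 * r * S := by nlinarith
      have h4 : ((q - 1) * (m * n)) ^ 2 ≤ (2 * r * S) ^ 2 :=
        pow_le_pow_left₀ (mul_nonneg (by linarith) (by positivity)) h3 2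
      have h5 : (2 * r * S) ^ 2 ≤ 4 * q * ((q ^ 2 * m) * (q ^ 2 * n - n ^ 2)) := by
        have : (2 * r * S) ^ 2 = 4 * q * S ^ 2 := by rw [← hr2]; ring
        rw [this]
        exact mul_le_mul_of_nonneg_left hS (by positivity)
      have h6 : (m * n) * ((q - 1) ^ 2 * (m * n)) ≤ (m * n) * (4 * q ^ 3 * (q ^ 2 - n)) := by
        calc _ = ((q - 1) * (m * n)) ^ 2 := by ring
          _ ≤ _ := h4.trans h5
          _ = _ := by ring
      have h7 := le_of_mul_le_mul_left h6 (by positivity)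
      have h8 : 4 * q ^ 3 * (q ^ 2 - n) ≤ 4 * q ^ 3 * (q - 1) ^ 2 :=
        mul_le_mul_of_nonneg_left (by nlinarith) (by positivity)
      have h9 : 0 < (q - 1) ^ 2 := by
        have : 0 < q - 1 := by linarith
        positivity
      have h10 : (q - 1) ^ 2 * (m * n) ≤ (q - 1) ^ 2 * (4 * q ^ 3) := by linarith
      exact le_of_mul_le_mul_left h10 h9
  · push Not at hbig
    have h1 : m * n ≤ n * n := mul_le_mul_of_nonneg_right hmn hn.le
    have h2 : n * n ≤ (2 * q) * (2 * q) := mul_self_le_mul_self hn.le (by linarith)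
    have h3 : q ^ 2 ≤ q ^ 3 := pow_le_pow_right₀ hq1'.le (by norm_num)
    nlinarith
end

section
/- Let F_q be a finite field of odd order q, let t ∈ F_q with t ≠ 0, and let E ⊆ F_q^2 with |E| ≥ 4 q^{3/2}. Then there exists u ∈ F_q^2 with ||u|| = t such that |E ∩ (E − u)| ≥ |E|^2 / (4 q^2), where E − u = {x − u : x ∈ E}. -/
open Finset

open Classical in
noncomputable def Kl {L : Type} [Field L] [Fintype L] (ψ : AddChar L ℂ) (a b : L) : ℂ :=
  ∑ x : L, if x = 0 then 0 else ψ (a * x + b * x⁻¹)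

lemma sum_sq_add_sum_nonsq {L : Type} [Field L] [Fintype L] (h2 : ringChar L ≠ 2)
    (δ : L) (hδ : ¬ IsSquare δ) (f : L → ℂ) :
    ∑ v, f (v ^ 2) + ∑ v, f (δ * v ^ 2) = 2 * ∑ w, f w := by
  classical
  have key : ∀ g : L → ℂ, ∑ v, g (v ^ 2) = ∑ w, g w * (1 + (quadraticChar L w : ℂ)) := by
    intro g
    have h1 : ∑ v, g (v ^ 2) = ∑ w, ∑ v with v ^ 2 = w, g (v ^ 2) :=
      (Finset.sum_fiberwise (s := univ) (fun v : L => v ^ 2) (fun v => g (v ^ 2))).symm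
    rw [h1]
    refine Finset.sum_congr rfl fun w _ => ?_
    rw [Finset.sum_congr rfl (g := fun _ => g w)
      (fun v hv => by rw [(Finset.mem_filter.mp hv).2])]
    have := quadraticChar_card_sqrts h2 w
    rw [Finset.sum_const, nsmul_eq_mul, mul_comm]
    congr 1
    have h3 : ((({x : L | x ^ 2 = w}.toFinset).card : ℤ) : ℂ) = ((quadraticChar L w + 1 : ℤ) : ℂ) := by
      rw [this]
    push_cast at h3
    rw [add_comm, ← h3]
    congr 2
    ext; simp
  have hδ0 : δ ≠ 0 := by rintro rfl; exact hδ (by simp)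
  have e : ∑ w, f (δ * w) * (1 + (quadraticChar L w : ℂ)) = ∑ w, f w * (1 - (quadraticChar L w : ℂ)) := by
    refine Fintype.sum_equiv (Equiv.mulLeft₀ δ hδ0) _ _ fun w => ?_
    simp [quadraticChar_neg_one_iff_not_isSquare.mpr hδ, map_mul]
  rw [key, key (fun w => f (δ * w)), e, ← Finset.sum_add_distrib, Finset.mul_sum]
  exact Finset.sum_congr rfl fun w _ => by ring

lemma quad_trace {L : Type} [Field L] (δ : L) (z : QuadraticAlgebra L δ 0) :
    Algebra.trace L (QuadraticAlgebra L δ 0) z = 2 * z.re := by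
  rw [Algebra.trace_eq_matrix_trace (QuadraticAlgebra.basis δ 0), Matrix.trace_fin_two,
    Algebra.leftMulMatrix_eq_repr_mul, Algebra.leftMulMatrix_eq_repr_mul]
  have h0 : (QuadraticAlgebra.basis δ 0) 0 = 1 := by
    apply (QuadraticAlgebra.basis δ 0).repr.injective
    ext i; fin_cases i <;> simp [QuadraticAlgebra.basis_repr_apply] <;> rfl
  have h1 : (QuadraticAlgebra.basis δ 0) 1 = ⟨0, 1⟩ := by
    apply (QuadraticAlgebra.basis δ 0).repr.injective
    ext i; fin_cases i <;> simp [QuadraticAlgebra.basis_repr_apply]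
  rw [h0, h1]
  simp [QuadraticAlgebra.basis_repr_apply]
  ring

noncomputable instance quadFintype {L : Type} [Field L] [Fintype L] (δ : L) :
    Fintype (QuadraticAlgebra L δ 0) := Fintype.ofEquiv _ (QuadraticAlgebra.equivProd δ 0).symm

lemma Kl_double {L : Type} [Field L] [Fintype L] (h2 : ringChar L ≠ 2)
    (δ : L) (hδ : ¬ IsSquare δ) [Fact (∀ r : L, r ^ 2 ≠ δ + 0 * r)] (ψ : AddChar L ℂ) (hψ : ψ ≠ 1)
    (a b : L) (ha : a ≠ 0) (hb : b ≠ 0) :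
    Kl (ψ.compAddMonoidHom (Algebra.trace L (QuadraticAlgebra L δ 0)).toAddMonoidHom)
      (algebraMap _ _ a) (algebraMap _ _ b) = 2 * (Fintype.card L : ℂ) - (Kl ψ a b) ^ 2 := by
  classical
  have h2' : (2 : L) ≠ 0 := Ring.two_ne_zero h2
  set h : L → L → ℂ := fun u w => if u ^ 2 = w then 0 else ψ (2 * a * u + 2 * b * u / (u ^ 2 - w)) with hh
  have hM : Kl (ψ.compAddMonoidHom (Algebra.trace L (QuadraticAlgebra L δ 0)).toAddMonoidHom)
      (algebraMap _ _ a) (algebraMap _ _ b) = ∑ u, ∑ v, h u (δ * v ^ 2) := by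
    rw [← Fintype.sum_prod_type', Kl]
    refine Fintype.sum_equiv (QuadraticAlgebra.equivProd δ 0) _ _ fun z => ?_
    have hz : z = 0 ↔ z.re ^ 2 = δ * z.im ^ 2 := by
      rw [← QuadraticAlgebra.norm_eq_zero_iff_eq_zero, QuadraticAlgebra.norm_def]
      constructor <;> intro h <;> linear_combination h
    simp only [hh, QuadraticAlgebra.equivProd, Equiv.coe_fn_mk]
    by_cases hz0 : z = 0
    · rw [if_pos hz0, if_pos (hz.1 hz0)]
    · rw [if_neg hz0, if_neg (fun h => hz0 (hz.2 h))]
      simp only [AddChar.compAddMonoidHom_apply, LinearMap.toAddMonoidHom_coe, quad_trace]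
      congr 1
      have : z.re ^ 2 - δ * z.im ^ 2 ≠ 0 := fun h => hz0 (hz.2 (by linear_combination h))
      simp [QuadraticAlgebra.norm_def]
      have e : z.re * z.re - δ * z.im * z.im = z.re ^ 2 - δ * z.im ^ 2 := by ring
      rw [e]
      field_simp
  have hK : (Kl ψ a b) ^ 2 = ∑ u, ∑ v, h u (v ^ 2) := by
    rw [pow_two, Kl, Finset.sum_mul_sum, ← Fintype.sum_prod_type', ← Fintype.sum_prod_type']
    symm
    refine Fintype.sum_equiv (⟨fun p => (p.1 + p.2, p.1 - p.2), fun p => ((p.1 + p.2) / 2, (p.1 - p.2) / 2),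
      fun p => by ext <;> simp <;> field_simp <;> ring, fun p => by ext <;> simp <;> field_simp <;> ring⟩ : L × L ≃ L × L) _ _ fun p => ?_
    obtain ⟨u, v⟩ := p
    simp only [hh, Equiv.coe_fn_mk]
    by_cases h1 : u + v = 0
    · rw [if_pos h1, if_pos (by linear_combination (u - v) * h1)]; simp
    by_cases h3 : u - v = 0
    · rw [if_pos h3, if_pos (by linear_combination (u + v) * h3)]; simp
    have h4 : u ^ 2 - v ^ 2 ≠ 0 := by
      rw [sq_sub_sq]; exact mul_ne_zero h1 h3
    rw [if_neg h1, if_neg h3, if_neg (fun h => h4 (by rw [h, sub_self])), ← AddChar.map_add_eq_mul]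
    congr 1
    have e : u ^ 2 - v ^ 2 = (u + v) * (u - v) := by ring
    rw [e]
    field_simp
    ring
  have hsum : ∑ u, ∑ v, h u (v ^ 2) + ∑ u, ∑ v, h u (δ * v ^ 2) = 2 * (Fintype.card L : ℂ) := by
    rw [← Finset.sum_add_distrib]
    simp_rw [sum_sq_add_sum_nonsq h2 δ hδ]
    rw [← Finset.mul_sum]
    congr 1
    have e1 : ∀ u, ∑ w, h u w = ∑ n : L, if n = 0 then 0 else ψ (u * (2 * (a + b / n))) := by
      intro u
      refine Fintype.sum_equiv (Equiv.subLeft (u ^ 2)) _ _ fun w => ?_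
      simp only [hh, Equiv.subLeft_apply, sub_eq_zero]
      split_ifs with hw
      · rfl
      · congr 1; ring
    simp_rw [e1]
    rw [Finset.sum_comm]
    have e2 : ∀ n : L, (∑ u : L, if n = 0 then (0:ℂ) else ψ (u * (2 * (a + b / n)))) =
        if n = - b / a then (Fintype.card L : ℂ) else 0 := by
      intro n
      by_cases hn : n = 0
      · subst hn
        have : (0 : L) ≠ - b / a := by
          intro h; rw [eq_div_iff ha] at h; apply hb; linear_combination h
        rw [if_neg this]; simp
      · simp only [hn, if_false]
        rw [AddChar.sum_mulShift _ (AddChar.IsPrimitive.of_ne_one hψ)]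
        have : 2 * (a + b / n) = 0 ↔ n = - b / a := by
          constructor
          · intro h
            have h := (mul_eq_zero.mp h).resolve_left h2'
            field_simp at h ⊢
            linear_combination h
          · rintro rfl
            field_simp
            ring
        simp only [this]
        push_cast
        rfl
    simp_rw [e2]
    simp
  rw [hM, hK]
  linear_combination hsum


lemma tower_step {L : Type} [Field L] [Fintype L] (hodd : Odd (Fintype.card L)) :
    ∃ (M : Type) (_ : Field M) (_ : Fintype M) (_ : Algebra L M),
      Fintype.card M = Fintype.card L ^ 2 ∧
      ∀ ψ : AddChar L ℂ, ψ ≠ 1 → ∀ a b : L, a ≠ 0 → b ≠ 0 →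
        Kl (ψ.compAddMonoidHom (Algebra.trace L M).toAddMonoidHom)
          (algebraMap _ _ a) (algebraMap _ _ b) = 2 * (Fintype.card L : ℂ) - (Kl ψ a b) ^ 2 := by
  have h2 : ringChar L ≠ 2 := by
    intro h
    have := FiniteField.even_card_iff_char_two.mp h
    rcases hodd with ⟨k, hk⟩
    omega
  obtain ⟨δ, hδ⟩ := FiniteField.exists_nonsquare h2
  haveI : Fact (∀ r : L, r ^ 2 ≠ δ + 0 * r) :=
    ⟨fun r hr => hδ ⟨r, by rw [← pow_two, hr]; ring⟩⟩
  refine ⟨QuadraticAlgebra L δ 0, inferInstance, inferInstance, inferInstance, ?_, ?_⟩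
  · rw [Fintype.card_congr (QuadraticAlgebra.equivProd δ 0), Fintype.card_prod, pow_two]
  · intro ψ hψ a b ha hb
    exact Kl_double h2 δ hδ ψ hψ a b ha hb

noncomputable def klseq (q : ℕ) (K : ℂ) : ℕ → ℂ
  | 0 => K
  | k + 1 => 2 * (q : ℂ) ^ (2 ^ k) - klseq q K k ^ 2

lemma comp_trace_ne_one {F L : Type} [Field F] [Field L] [Fintype F] [Fintype L] [Algebra F L]
    {ψ : AddChar F ℂ} (hψ : ψ ≠ 1) :
    ψ.compAddMonoidHom (Algebra.trace F L).toAddMonoidHom ≠ 1 := by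
  obtain ⟨x, hx⟩ := AddChar.ne_one_iff.mp hψ
  obtain ⟨z, hz⟩ := Algebra.trace_surjective F L x
  exact AddChar.ne_one_iff.mpr ⟨z, by simpa [hz] using hx⟩

lemma tower {F : Type} [Field F] [Fintype F] (hodd : Odd (Fintype.card F)) (a b : F)
    (ha : a ≠ 0) (hb : b ≠ 0) (k : ℕ) :
    ∃ (L : Type) (_ : Field L) (_ : Fintype L) (_ : Algebra F L),
      Fintype.card L = Fintype.card F ^ (2 ^ k) ∧
      ∀ ψ : AddChar F ℂ, ψ ≠ 1 →
        Kl (ψ.compAddMonoidHom (Algebra.trace F L).toAddMonoidHom)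
          (algebraMap _ _ a) (algebraMap _ _ b) = klseq (Fintype.card F) (Kl ψ a b) k := by
  induction k with
  | zero =>
    refine ⟨F, inferInstance, inferInstance, inferInstance, by simp, fun ψ _ => ?_⟩
    simp only [klseq]
    congr 1
    ext x
    simp [Algebra.trace_self_apply]
  | succ k ih =>
    obtain ⟨L, _, _, _, hc, hL⟩ := ih
    obtain ⟨M, _, _, _, hcM, hM⟩ := tower_step (L := L) (by rw [hc]; exact hodd.pow)
    letI : Algebra F M := ((algebraMap L M).comp (algebraMap F L)).toAlgebra
    haveI : IsScalarTower F L M := IsScalarTower.of_algebraMap_eq' rfl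
    refine ⟨M, inferInstance, inferInstance, inferInstance, ?_, fun ψ hψ => ?_⟩
    · rw [hcM, hc, ← pow_mul, pow_succ]
    · have h1 := hM _ (comp_trace_ne_one (L := L) hψ) (algebraMap F L a) (algebraMap F L b)
        (by simpa using ha) (by simpa using hb)
      rw [hL ψ hψ, hc] at h1
      rw [klseq]
      push_cast at h1
      rw [← h1]
      congr 1
      ext x
      simp [Algebra.trace_trace]


section Step
open Polynomial

variable {L : Type} [Field L]

/-- all `Y`-coefficients have `X`-degree at most `d` -/
def XD (P : Polynomial (Polynomial L)) (d : ℕ) : Prop := ∀ k, (P.coeff k).natDegree ≤ d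

lemma XD.mono {P : Polynomial (Polynomial L)} {d d' : ℕ} (h : XD P d) (hd : d ≤ d') : XD P d' :=
  fun k => (h k).trans hd

lemma XD.add {P Q : Polynomial (Polynomial L)} {d : ℕ} (hP : XD P d) (hQ : XD Q d) :
    XD (P + Q) d := fun k => by
  rw [coeff_add]; exact natDegree_add_le_of_degree_le (hP k) (hQ k)

lemma XD.mul {P Q : Polynomial (Polynomial L)} {d e : ℕ} (hP : XD P d) (hQ : XD Q e) :
    XD (P * Q) (d + e) := fun k => by
  rw [coeff_mul]
  exact natDegree_sum_le_of_forall_le _ _ fun p _ =>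
    natDegree_mul_le_of_le (hP _) (hQ _)

lemma XD.C {p : Polynomial L} {d : ℕ} (h : p.natDegree ≤ d) : XD (Polynomial.C p) d := fun k => by
  rw [coeff_C]; split_ifs <;> simp [h]

lemma XD.Xpow (n : ℕ) : XD (X ^ n : Polynomial (Polynomial L)) 0 := fun k => by
  rw [coeff_X_pow]; split_ifs <;> simp

lemma XD.pow {P : Polynomial (Polynomial L)} {d : ℕ} (h : XD P d) (n : ℕ) : XD (P ^ n) (d * n) := by
  induction n with
  | zero => simpa using XD.Xpow (L := L) 0
  | succ n ih => rw [pow_succ, Nat.mul_succ]; exact ih.mul h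

noncomputable def red (q : ℕ) (γ : Polynomial L) (t : ℕ) :
    Polynomial (Polynomial L) →ₗ[L] Polynomial L where
  toFun P := X * P.coeff t + γ * P.coeff (t + q) + if t = 0 then 0 else X * P.coeff (t + q - 1)
  map_add' P Q := by simp only [coeff_add]; split_ifs <;> ring
  map_smul' c P := by
    simp only [coeff_smul, RingHom.id_apply, smul_add, mul_smul_comm]
    split_ifs <;> simp

lemma red_apply (q : ℕ) (γ : Polynomial L) (t : ℕ) (P : Polynomial (Polynomial L)) :
    red q γ t P = X * P.coeff t + γ * P.coeff (t + q) +
      if t = 0 then 0 else X * P.coeff (t + q - 1) := rfl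

lemma red_natDegree (q : ℕ) {γ : Polynomial L} (hγ : γ.natDegree ≤ 2) (t : ℕ)
    {P : Polynomial (Polynomial L)} {d : ℕ} (h : XD P d) : (red q γ t P).natDegree ≤ d + 2 := by
  rw [red_apply]
  have h1 : ∀ k, (X * P.coeff k).natDegree ≤ d + 2 := fun k =>
    (natDegree_mul_le_of_le natDegree_X_le (h k)).trans (by omega)
  refine natDegree_add_le_of_degree_le (natDegree_add_le_of_degree_le (h1 _) ?_) ?_
  · exact (natDegree_mul_le_of_le hγ (h _)).trans (by omega)
  · split_ifs
    · simp
    · exact h1 _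

lemma red_eval (q : ℕ) (hq : 1 ≤ q) (γ : Polynomial L) (P : Polynomial (Polynomial L))
    (hP : P.natDegree + 1 < 2 * q) (x y : L) (hxy : x * y ^ q = x * y + γ.eval x) :
    x * P.evalEval x y = ∑ t ∈ range q, (red q γ t P).eval x * y ^ t := by
  have e1 : P.evalEval x y = ∑ k ∈ range (q + q), (P.coeff k).eval x * y ^ k := by
    rw [evalEval, eval_eq_sum_range' (p := P) (n := q + q) (by omega), eval_finsetSum]
    simp
  rw [e1, sum_range_add]
  have e2 : ∀ t, x * ((P.coeff (q + t)).eval x * y ^ (q + t)) =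
      (P.coeff (q + t)).eval x * x * y ^ (t + 1) + γ.eval x * (P.coeff (q + t)).eval x * y ^ t := by
    intro t
    rw [pow_add]
    linear_combination (P.coeff (q + t)).eval x * y ^ t * hxy
  rw [mul_add, mul_sum, mul_sum, sum_congr rfl (fun t _ => e2 t), sum_add_distrib]
  have e3 : ∑ t ∈ range q, (P.coeff (q + t)).eval x * x * y ^ (t + 1) =
      ∑ t ∈ range q, (if t = 0 then 0 else x * (P.coeff (t + q - 1)).eval x * y ^ t) := by
    have a1 := sum_range_succ' (fun t => if t = 0 then 0 else x * (P.coeff (t + q - 1)).eval x * y ^ t) q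
    have a2 := sum_range_succ (fun t => if t = 0 then 0 else x * (P.coeff (t + q - 1)).eval x * y ^ t) q
    rw [a2] at a1
    have hz : P.coeff (q + q - 1) = 0 := coeff_eq_zero_of_natDegree_lt (by omega)
    simp only [hz] at a1
    simp only [eval_zero, mul_zero, zero_mul, ite_self, add_zero, if_true] at a1
    rw [a1]
    refine sum_congr rfl fun t _ => ?_
    rw [if_neg (by omega), show t + 1 + q - 1 = q + t by omega]
    ring
  rw [e3, ← sum_add_distrib, ← sum_add_distrib]
  refine sum_congr rfl fun t _ => ?_
  rw [red_apply]
  split_ifs <;> simp [add_comm q t] <;> ring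

noncomputable def WW (ρ : ℕ) (Γ : Polynomial L) : Polynomial (Polynomial L) :=
  C (X ^ ρ) * X ^ 1 + C Γ

lemma WW_XD (ρ : ℕ) (Γ : Polynomial L) (hΓ : Γ.natDegree ≤ 2 * ρ) : XD (WW ρ Γ) (2 * ρ) := by
  refine XD.add (((XD.C (d := ρ) (by simp)).mul (XD.Xpow 1)).mono (by omega)) (XD.C hΓ)

lemma WW_natDegree (ρ : ℕ) (Γ : Polynomial L) : (WW ρ Γ).natDegree ≤ 1 := by
  unfold WW
  compute_degree

lemma WW_err (ρ : ℕ) (Γ : Polynomial L) (hΓ : Γ.natDegree ≤ 2 * ρ) (j : ℕ) :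
    ∃ E : Polynomial (Polynomial L), WW ρ Γ ^ j = C (Γ ^ j) + E ∧ XD E (2 * ρ * j - ρ) ∧ (j = 0 → E = 0) := by
  induction j with
  | zero => exact ⟨0, by simp, fun k => by simp, fun _ => rfl⟩
  | succ j ih =>
    obtain ⟨E, h1, h2, h3⟩ := ih
    refine ⟨E * WW ρ Γ + C (Γ ^ j * X ^ ρ) * X ^ 1, ?_, ?_, by omega⟩
    · rw [pow_succ, h1]
      nth_rewrite 1 [WW]
      simp only [map_mul, map_pow]
      rw [WW]
      simp only [map_mul, map_pow]
      ring
    · refine XD.add ?_ (((XD.C (d := 2 * ρ * j + ρ) ?_).mul (XD.Xpow 1)).mono ?_)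
      · rcases Nat.eq_zero_or_pos j with rfl | hj
        · rw [h3 rfl]; intro k; simp
        · have : ρ ≤ 2 * ρ * j := by nlinarith
          refine (h2.mul (WW_XD ρ Γ hΓ)).mono ?_
          rw [Nat.mul_succ]; omega
      · refine natDegree_mul_le_of_le ?_ (by simp)
        exact (natDegree_pow_le_of_le j hΓ).trans (by rw [Nat.mul_comm])
      · rw [Nat.mul_succ]; omega

noncomputable def VV (ρ : ℕ) (Γ : Polynomial L) (c j k : ℕ) : Polynomial (Polynomial L) :=
  C (X ^ c) * WW ρ Γ ^ j * X ^ k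

lemma VV_XD (ρ : ℕ) (Γ : Polynomial L) (hΓ : Γ.natDegree ≤ 2 * ρ) (c j k : ℕ) :
    XD (VV ρ Γ c j k) (c + 2 * ρ * j) :=
  ((XD.C (by simp)).mul ((WW_XD ρ Γ hΓ).pow j)).mul (XD.Xpow k)

lemma VV_natDegree (ρ : ℕ) (Γ : Polynomial L) (c j k : ℕ) :
    (VV ρ Γ c j k).natDegree ≤ j + k := by
  unfold VV
  refine natDegree_mul_le_of_le ?_ (natDegree_X_pow_le k)
  have := natDegree_mul_le_of_le (p := (C (X ^ c) : Polynomial (Polynomial L))) (m := 0) (by simp)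
    (natDegree_pow_le_of_le j (WW_natDegree ρ Γ))
  simpa using this

lemma VV_eval (ρ R : ℕ) (Γ : Polynomial L) (c j k : ℕ) (x y : L)
    (h : x ^ ρ * y ^ R = x ^ ρ * y + Γ.eval x) :
    (VV ρ Γ c j k).evalEval x y = x ^ (c + ρ * j) * y ^ (R * j + k) := by
  have : (WW ρ Γ).evalEval x y = x ^ ρ * y ^ R := by
    rw [h]; simp only [WW, evalEval]; simp; try ring
  rw [evalEval] at this ⊢
  simp only [VV, eval_mul, eval_pow, this]
  simp
  ring

/-- coefficient of the reduction -/
lemma red_VV_coeff (q ρ : ℕ) (hq : 1 ≤ q) (γ Γ : Polynomial L) (hγ : γ.natDegree ≤ 2)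
    (hΓ : Γ.natDegree ≤ 2 * ρ) (c j k t n : ℕ) (hk : k < q) (ht : t < q)
    (hn : c + 2 * ρ * j + 2 < n + ρ) :
    (red q γ t (VV ρ Γ c j k)).coeff n = if k = t then (X ^ (c + 1) * Γ ^ j).coeff n else 0 := by
  obtain ⟨E, h1, h2, h3⟩ := WW_err ρ Γ hΓ j
  have e : VV ρ Γ c j k = C (X ^ c * Γ ^ j) * X ^ k + C (X ^ c) * E * X ^ k := by
    rw [VV, h1, map_mul]; ring
  rw [e, map_add, coeff_add]
  have z : (red q γ t (C (X ^ c) * E * X ^ k)).coeff n = 0 := by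
    rcases Nat.eq_zero_or_pos j with rfl | hj
    · rw [h3 rfl]; simp
    · have hρ : ρ ≤ 2 * ρ * j := by nlinarith
      apply coeff_eq_zero_of_natDegree_lt
      refine lt_of_le_of_lt (red_natDegree q hγ t (((XD.C (d := c) (by simp)).mul h2).mul (XD.Xpow k))) ?_
      omega
  rw [z, add_zero, red_apply]
  simp only [coeff_C_mul, coeff_X_pow]
  have a1 : t + q ≠ k := by omega
  rw [if_neg a1]
  have a2 : (if t = 0 then (0 : Polynomial L) else X * (X ^ c * Γ ^ j * if t + q - 1 = k then 1 else 0)) = 0 := by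
    split_ifs <;> first | omega | simp
  rw [a2]
  by_cases hkt : k = t
  · subst hkt
    rw [if_pos rfl, if_pos rfl, pow_succ]
    congr 1
    ring
  · rw [if_neg hkt, if_neg (fun h => hkt h.symm)]
    simp

lemma stepanov_core [DecidableEq L] (p e : ℕ) [Fact p.Prime] [CharP L p] (q ρ ℓ m R : ℕ) (hq : 2 ≤ q)
    (hR : R = q * ρ) (hRp : R = p ^ e) (hcard : ∀ z : L, z ^ (R * R) = z)
    (hℓ : ℓ + 1 ≤ ρ) (hcount : (ℓ + 1) * R + m + 2 < ℓ * q * m)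
    (γ Γ : Polynomial L) (hγ : γ.natDegree ≤ 2) (hΓ : Γ.natDegree = 2 * ρ)
    (S : Finset L) (hS0 : ∀ x ∈ S, x ≠ 0) (Ys : L → Finset L)
    (hY : ∀ x ∈ S, (Ys x).card = q)
    (hY1 : ∀ x ∈ S, ∀ y ∈ Ys x, x * y ^ q = x * y + γ.eval x)
    (hY2 : ∀ x ∈ S, ∀ y ∈ Ys x, x ^ ρ * y ^ R = x ^ ρ * y + Γ.eval x) :
    S.card ≤ (m + 1) * R + ℓ + 1 := by
  have hΓ' := hΓ.le
  have hℓ0 : 0 < ℓ := by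
    rcases Nat.eq_zero_or_pos ℓ with rfl | h
    · simp at hcount
    · exact h
  have hq0 : 0 < q := by omega
  set N := (ℓ + 1) * R + m + 2 with hN
  let Idx := Fin (q * m) × Fin ℓ × Fin q
  let U : Idx → Polynomial (Polynomial L) := fun i =>
    VV ρ Γ (i.2.1 * R + (R - ρ * i.2.2) + i.1 / q) i.2.2 (i.1 % q)
  let V : Idx → Polynomial (Polynomial L) := fun i =>
    VV ρ Γ (i.2.1 + (i.1 / q) * R + (R - ρ * (i.1 % q))) (i.1 % q) i.2.2
  have hdiv : ∀ i : Idx, (i.1 : ℕ) / q < m := fun i =>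
    Nat.div_lt_of_lt_mul i.1.2
  have hmod : ∀ i : Idx, (i.1 : ℕ) % q < q := fun i => Nat.mod_lt _ hq0
  have hsub : ∀ j, j < q → ρ * j + ρ ≤ R := fun j hj => by
    rw [hR]; nlinarith
  have hUX : ∀ i t, (red q γ t (U i)).natDegree < N := by
    intro i t
    have h1 := red_natDegree q hγ t (VV_XD ρ Γ hΓ' (i.2.1 * R + (R - ρ * i.2.2) + i.1 / q) i.2.2 (i.1 % q))
    refine lt_of_le_of_lt h1 ?_
    have h2 := hdiv i
    have h3 := hsub i.2.2 i.2.2.2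
    have h4 : (i.2.1 : ℕ) * R + R ≤ ℓ * R := by
      have := i.2.1.2
      nlinarith
    have h5 : 2 * ρ * (i.2.2 : ℕ) = ρ * i.2.2 + ρ * i.2.2 := by ring
    rw [hN, add_mul]
    omega
  have hUe : ∀ i, ∀ x ∈ S, ∀ y ∈ Ys x, (U i).evalEval x y =
      x ^ R * (x ^ ((i.2.1 : ℕ) * R) * y ^ ((i.2.2 : ℕ) * R) * (x ^ ((i.1 : ℕ) / q) * y ^ ((i.1 : ℕ) % q))) := by
    intro i x hx y hy
    rw [VV_eval ρ R Γ _ _ _ x y (hY2 x hx y hy)]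
    have h3 := hsub i.2.2 i.2.2.2
    have : (i.2.1 : ℕ) * R + (R - ρ * i.2.2) + i.1 / q + ρ * i.2.2 = R + i.2.1 * R + i.1 / q := by omega
    rw [this]
    ring
  have hVe : ∀ i, ∀ x ∈ S, ∀ y ∈ Ys x, (V i).evalEval x y =
      x ^ R * (x ^ (i.2.1 : ℕ) * y ^ (i.2.2 : ℕ) * (x ^ ((i.1 : ℕ) / q) * y ^ ((i.1 : ℕ) % q)) ^ R) := by
    intro i x hx y hy
    rw [VV_eval ρ R Γ _ _ _ x y (hY2 x hx y hy)]
    have h3 := hsub _ (hmod i)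
    have : (i.2.1 : ℕ) + (i.1 / q) * R + (R - ρ * (i.1 % q)) + ρ * (i.1 % q) = R + i.2.1 + i.1 / q * R := by omega
    rw [this]
    ring
  have hUd : ∀ i, (U i).natDegree + 1 < 2 * q := by
    intro i
    have h1 : (U i).natDegree ≤ _ := VV_natDegree ρ Γ _ _ _
    have := i.2.2.2
    have := hmod i
    omega
  have hVd : ∀ i, (V i).natDegree + 1 < 2 * q := by
    intro i
    have h1 : (V i).natDegree ≤ _ := VV_natDegree ρ Γ _ _ _
    have := i.2.2.2
    have := hmod i
    omega
  -- the linear system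
  let T : (Idx → L) →ₗ[L] (Fin q × Fin N → L) :=
    { toFun := fun τ tn => ∑ i, τ i * (red q γ tn.1 (U i)).coeff tn.2
      map_add' := fun a b => by ext; simp [add_mul, sum_add_distrib]
      map_smul' := fun c a => by ext; simp [mul_assoc, mul_sum] }
  have hker : LinearMap.ker T ≠ ⊥ := by
    apply LinearMap.ker_ne_bot_of_finrank_lt
    simp only [Module.finrank_fintype_fun_eq_card, Fintype.card_prod, Fintype.card_fin, Idx]
    calc q * N < q * (ℓ * q * m) := by exact Nat.mul_lt_mul_of_pos_left hcount hq0
      _ = q * m * (ℓ * q) := by ring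
  obtain ⟨τ, hτ, hτ0⟩ := (Submodule.ne_bot_iff _).mp hker
  have hsys : ∀ t, t < q → ∑ i, τ i • red q γ t (U i) = 0 := by
    intro t ht
    ext n
    rw [finsetSum_coeff]
    simp only [coeff_smul, smul_eq_mul, coeff_zero]
    by_cases hn : n < N
    · exact congrFun (LinearMap.mem_ker.mp hτ) (⟨t, ht⟩, ⟨n, hn⟩)
    · refine sum_eq_zero fun i _ => ?_
      rw [coeff_eq_zero_of_natDegree_lt (lt_of_lt_of_le (hUX i t) (by omega)), mul_zero]
  have hsum0 : ∀ x ∈ S, ∀ y ∈ Ys x,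
      ∑ i, τ i * (x ^ ((i.2.1 : ℕ) * R) * y ^ ((i.2.2 : ℕ) * R) * (x ^ ((i.1 : ℕ) / q) * y ^ ((i.1 : ℕ) % q))) = 0 := by
    intro x hx y hy
    have h1 : ∑ i, τ i * (x * (U i).evalEval x y) = 0 := by
      simp_rw [fun i => red_eval q (by omega) γ (U i) (hUd i) x y (hY1 x hx y hy), mul_sum]
      rw [sum_comm]
      refine sum_eq_zero fun t ht => ?_
      have := congrArg (fun P => P.eval x * y ^ t) (hsys t (mem_range.mp ht))
      simp only [eval_finsetSum, eval_smul, smul_eq_mul, eval_zero, zero_mul, sum_mul] at this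
      rw [← this]
      exact sum_congr rfl fun i _ => by ring
    have h2 : x * x ^ R * ∑ i, τ i * (x ^ ((i.2.1 : ℕ) * R) * y ^ ((i.2.2 : ℕ) * R) * (x ^ ((i.1 : ℕ) / q) * y ^ ((i.1 : ℕ) % q))) = 0 := by
      rw [← h1, mul_sum]
      refine sum_congr rfl fun i _ => ?_
      rw [hUe i x hx y hy]; ring
    exact (mul_eq_zero.mp h2).resolve_left (mul_ne_zero (hS0 x hx) (pow_ne_zero _ (hS0 x hx)))
  let σ : Idx → L := fun i => τ i ^ R
  have hστ : ∀ i, σ i ^ R = τ i := fun i => by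
    show (τ i ^ R) ^ R = τ i
    rw [← pow_mul, hcard]
  have hR0 : R ≠ 0 := by rw [hRp]; exact pow_ne_zero _ (Fact.out (p := p.Prime)).ne_zero
  let P := ∑ i, σ i • V i
  have hP0 : ∀ x ∈ S, ∀ y ∈ Ys x, P.evalEval x y = 0 := by
    intro x hx y hy
    have e1 : P.evalEval x y = ∑ i, σ i * (V i).evalEval x y := by
      simp only [P, evalEval, eval_finsetSum, eval_smul, smul_eq_mul]
    rw [e1]
    apply pow_eq_zero_iff hR0 |>.mp
    rw [hRp, sum_pow_char_pow p e, ← hRp]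
    have e2 : ∀ i, (σ i * (V i).evalEval x y) ^ R = (x ^ R) ^ R *
       (τ i * (x ^ ((i.2.1 : ℕ) * R) * y ^ ((i.2.2 : ℕ) * R) * (x ^ ((i.1 : ℕ) / q) * y ^ ((i.1 : ℕ) % q)))) := by
      intro i
      have e3 : ((x ^ ((i.1 : ℕ) / q) * y ^ ((i.1 : ℕ) % q)) ^ R) ^ R =
          x ^ ((i.1 : ℕ) / q) * y ^ ((i.1 : ℕ) % q) := by rw [← pow_mul, hcard]
      rw [hVe i x hx y hy, mul_pow, hστ, mul_pow, mul_pow _ (_ ^ R), e3,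
        mul_pow, ← pow_mul x (i.2.1 : ℕ), ← pow_mul y (i.2.2 : ℕ)]
      ring
    rw [sum_congr rfl fun i _ => e2 i, ← mul_sum, hsum0 x hx y hy, mul_zero]
  have hPd : P.natDegree + 1 < 2 * q := by
    have : P.natDegree ≤ 2 * q - 2 := natDegree_sum_le_of_forall_le _ _ fun i _ =>
      (natDegree_smul_le _ _).trans (by have := hVd i; omega)
    omega
  have hred0 : ∀ x ∈ S, ∀ t < q, (red q γ t P).eval x = 0 := by
    intro x hx
    let Z : Polynomial L := ∑ t ∈ range q, C ((red q γ t P).eval x) * X ^ t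
    have hZ : Z = 0 := by
      apply eq_zero_of_natDegree_lt_card_of_eval_eq_zero' Z (Ys x)
      · intro y hy
        have := red_eval q (by omega) γ P hPd x y (hY1 x hx y hy)
        rw [hP0 x hx y hy, mul_zero] at this
        simp [Z, eval_finsetSum, ← this]
      · rw [hY x hx]
        have : Z.natDegree ≤ q - 1 := natDegree_sum_le_of_forall_le _ _ fun t ht =>
          (natDegree_C_mul_X_pow_le _ _).trans (by have := mem_range.mp ht; omega)
        omega
    intro t ht
    have := congrArg (fun A => A.coeff t) hZ
    simpa [Z, finsetSum_coeff, coeff_C_mul, coeff_X_pow, ht] using this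
  -- nonvanishing
  have hne : ∃ t < q, red q γ t P ≠ 0 := by
    have hex : (univ.filter fun i => σ i ≠ 0).Nonempty := by
      obtain ⟨i, hi⟩ := Function.ne_iff.mp hτ0
      refine ⟨i, mem_filter.mpr ⟨mem_univ _, fun h => hi ?_⟩⟩
      rw [← hστ i, h, zero_pow hR0]; rfl
    obtain ⟨i0, hi0, hmax⟩ := exists_max_image _ (fun i : Idx => (i.1 : ℕ) * ℓ + i.2.1) hex
    have hσ0 := (mem_filter.mp hi0).2
    refine ⟨i0.2.2, i0.2.2.2, fun hz => ?_⟩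
    have hkey : ∀ i : Idx, (i.1 / q) * R + (R - ρ * (i.1 % q)) + 2 * ρ * (i.1 % q) = R + ρ * i.1 := by
      intro i
      have h3 := hsub _ (hmod i)
      have h4 : ρ * (i.1 : ℕ) = (i.1 / q) * R + ρ * (i.1 % q) := by
        conv_lhs => rw [← Nat.div_add_mod (i.1 : ℕ) q]
        rw [hR]; ring
      have h5 : 2 * ρ * ((i.1 : ℕ) % q) = ρ * (i.1 % q) + ρ * (i.1 % q) := by ring
      omega
    set n0 := 1 + R + ρ * i0.1 + i0.2.1 with hn0
    have hc := congrArg (fun A => A.coeff n0) hz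
    simp only [P, map_sum, map_smul, finsetSum_coeff, coeff_smul, smul_eq_mul, coeff_zero] at hc
    rw [sum_eq_single i0] at hc
    · rw [red_VV_coeff q ρ (by omega) γ Γ hγ hΓ' _ _ _ _ _ i0.2.2.2 i0.2.2.2
        (by have := hkey i0; have := i0.2.1.2; omega), if_pos rfl] at hc
      have := hkey i0
      rw [show n0 = 2 * ρ * (i0.1 % q) + (i0.2.1 + (i0.1 / q) * R + (R - ρ * (i0.1 % q)) + 1) by omega,
        coeff_X_pow_mul, ← hΓ, mul_comm Γ.natDegree, coeff_pow_mul_natDegree] at hc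
      have hΓ0 : Γ ≠ 0 := by
        rintro rfl
        simp at hΓ
        omega
      exact (mul_ne_zero hσ0 (pow_ne_zero _ (leadingCoeff_ne_zero.mpr hΓ0))) hc
    · intro i _ hii
      by_cases hσi : σ i = 0
      · rw [hσi, zero_mul]
      have hm := hmax i (mem_filter.mpr ⟨mem_univ _, hσi⟩)
      have hl := i.2.1.2
      have hl0 := i0.2.1.2
      have hle : (i.1 : ℕ) ≤ i0.1 := by
        by_contra hlt
        push Not at hlt
        have : ((i0.1 : ℕ) + 1) * ℓ ≤ i.1 * ℓ := Nat.mul_le_mul_right _ hlt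
        rw [add_mul] at this
        omega
      have hki := hkey i
      rcases hle.lt_or_eq with hlt | heq
      · have h6 : ρ * (i.1 : ℕ) + ρ ≤ ρ * i0.1 := by
          have := Nat.mul_le_mul_left ρ (Nat.succ_le_of_lt hlt)
          rw [Nat.mul_succ] at this
          exact this
        rw [coeff_eq_zero_of_natDegree_lt, mul_zero]
        refine lt_of_le_of_lt (red_natDegree q hγ _ (VV_XD ρ Γ hΓ' _ _ _)) ?_
        omega
      · rw [red_VV_coeff q ρ (by omega) γ Γ hγ hΓ' _ _ _ _ _ i.2.2.2 i0.2.2.2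
          (by rw [heq] at hki ⊢; omega)]
        split_ifs with hj
        · have hlle : (i.2.1 : ℕ) < i0.2.1 := by
            rw [heq] at hm
            have h7 : (i.2.1 : ℕ) ≤ i0.2.1 := by omega
            refine lt_of_le_of_ne h7 fun h8 => hii ?_
            exact Prod.ext (Fin.ext heq) (Prod.ext (Fin.ext h8) (Fin.ext hj))
          rw [coeff_eq_zero_of_natDegree_lt, mul_zero]
          refine lt_of_le_of_lt (natDegree_mul_le_of_le (natDegree_X_pow_le _) (natDegree_pow_le_of_le _ hΓ')) ?_
          rw [heq] at hki ⊢
          have h9 : ((i0.1 : ℕ) % q) * (2 * ρ) = 2 * ρ * (i0.1 % q) := mul_comm _ _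
          omega
        · rw [mul_zero]
    · simp
  obtain ⟨t, ht, hrt⟩ := hne
  have hfin : (red q γ t P).natDegree ≤ (m + 1) * R + ℓ + 1 := by
    simp only [P, map_sum, map_smul]
    refine natDegree_sum_le_of_forall_le _ _ fun i _ => (natDegree_smul_le _ _).trans ?_
    refine (red_natDegree q hγ _ (VV_XD ρ Γ hΓ' _ _ _)).trans ?_
    have h1 := hdiv i
    have h3 := hsub _ (hmod i)
    have h4 : ((i.1 : ℕ) / q) * R + R ≤ m * R := by
      nlinarith
    have h5 : 2 * ρ * ((i.1 : ℕ) % q) = ρ * (i.1 % q) + ρ * (i.1 % q) := by ring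
    have := i.2.1.2
    rw [add_mul]
    omega
  by_contra hlt
  exact hrt (eq_zero_of_natDegree_lt_card_of_eval_eq_zero' _ S (fun x hx => hred0 x hx t ht) (by omega))

end Step


section AS
variable {F L : Type} [Field F] [Fintype F] [Field L] [Fintype L] [Algebra F L] 

noncomputable def asMap (F L : Type) [Field F] [Fintype F] [Field L] [Algebra F L] : L →ₗ[F] L :=
  (FiniteField.frobeniusAlgHom F L).toLinearMap - LinearMap.id

lemma asMap_apply (y : L) : asMap F L y = y ^ (Fintype.card F) - y := rfl

lemma asMap_ker_card [DecidableEq L] : (univ.filter fun y : L => asMap F L y = 0).card = Fintype.card F := by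
  apply le_antisymm
  · set P : Polynomial L := Polynomial.X ^ (Fintype.card F) - Polynomial.X
    have hP : P ≠ 0 := FiniteField.X_pow_card_sub_X_ne_zero L Fintype.one_lt_card
    calc _ ≤ P.roots.toFinset.card := card_le_card fun y hy => by
            rw [Multiset.mem_toFinset, Polynomial.mem_roots hP]
            simpa [P, asMap_apply] using (mem_filter.mp hy).2
      _ ≤ P.roots.card := Multiset.toFinset_card_le _
      _ ≤ P.natDegree := P.card_roots'
      _ = _ := FiniteField.X_pow_card_sub_X_natDegree_eq L Fintype.one_lt_card
  · rw [← Finset.card_univ, ← card_map ⟨algebraMap F L, (algebraMap F L).injective⟩]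
    refine card_le_card fun y hy => ?_
    simp only [mem_map, mem_univ, true_and, Function.Embedding.coeFn_mk, mem_filter] at hy ⊢
    obtain ⟨x, rfl⟩ := hy
    rw [asMap_apply, ← map_pow, FiniteField.pow_card, sub_self]

lemma as_fiber [DecidableEq L] (z : L) (hz : Algebra.trace F L z = 0) :
    (univ.filter fun y : L => y ^ (Fintype.card F) - y = z).card = Fintype.card F := by
  have hk : Module.finrank F (LinearMap.ker (asMap F L)) = 1 := by
    let _ : Fintype (LinearMap.ker (asMap F L)) := Fintype.ofFinite _
    have h1 := Module.card_eq_pow_finrank (K := F) (V := LinearMap.ker (asMap F L))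
    have h2 : Fintype.card (LinearMap.ker (asMap F L)) = Fintype.card F := by
      rw [← asMap_ker_card (F := F) (L := L), ← Fintype.card_subtype]
      exact Fintype.card_congr (Equiv.refl _)
    rw [h2] at h1
    have h3 : Fintype.card F ^ 1 = Fintype.card F ^ Module.finrank F (LinearMap.ker (asMap F L)) := by
      rw [pow_one]; exact h1
    exact (Nat.pow_right_injective Fintype.one_lt_card h3).symm
  have h1 := LinearMap.finrank_range_add_finrank_ker (asMap F L)
  have h2 := LinearMap.finrank_range_add_finrank_ker (Algebra.trace F L)
  rw [LinearMap.range_eq_top.mpr (Algebra.trace_surjective F L), finrank_top, Module.finrank_self] at h2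
  have hle : LinearMap.range (asMap F L) ≤ LinearMap.ker (Algebra.trace F L) := by
    rintro _ ⟨y, rfl⟩
    rw [LinearMap.mem_ker, asMap_apply, map_sub, sub_eq_zero]
    exact Algebra.trace_eq_of_algEquiv (FiniteField.frobeniusAlgEquivOfAlgebraic F L) y
  have heq := Submodule.eq_of_le_of_finrank_eq hle (by omega)
  have hz' : z ∈ LinearMap.range (asMap F L) := by rw [heq]; exact hz
  obtain ⟨y0, hy0⟩ := hz'
  refine Eq.trans ?_ (asMap_ker_card (F := F) (L := L))
  refine card_bij (fun y _ => y - y0) ?_ ?_ ?_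
  · intro y hy
    simp only [mem_filter, mem_univ, true_and] at hy ⊢
    rw [map_sub, hy0, asMap_apply, hy, sub_self]
  · intro a _ b _ h
    exact sub_left_injective h
  · intro w hw
    simp only [mem_filter, mem_univ, true_and] at hw ⊢
    refine ⟨w + y0, ?_, by ring⟩
    rw [← asMap_apply (F := F), map_add, hw, hy0, zero_add]

lemma as_iter (r : ℕ) (y g : L) (h : y ^ (Fintype.card F) - y = g) :
    y ^ (Fintype.card F ^ r) = y + ∑ i ∈ range r, g ^ (Fintype.card F ^ i) := by
  induction r with
  | zero => simp
  | succ r ih =>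
    have hadd : ∀ u v : L, (u + v) ^ (Fintype.card F ^ r) = u ^ (Fintype.card F ^ r) + v ^ (Fintype.card F ^ r) := by
      intro u v
      have := map_add (((FiniteField.frobeniusAlgHom F L) ^ r : L →ₐ[F] L)) u v
      simp only [AlgHom.coe_pow, FiniteField.coe_frobeniusAlgHom, pow_iterate] at this
      exact this
    rw [pow_succ', pow_mul, show y ^ Fintype.card F = y + g by rw [← h]; ring, hadd, ih, sum_range_succ]
    ring


noncomputable def Gam (F : Type) {L : Type} [Field F] [Fintype F] [Field L] (a b e : L) (s : ℕ) :
    Polynomial L :=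
  ∑ i ∈ range (s + 1), (Polynomial.C a * Polynomial.X ^ (Fintype.card F ^ s + Fintype.card F ^ i)
    + Polynomial.C b * Polynomial.X ^ (Fintype.card F ^ s - Fintype.card F ^ i)
    - Polynomial.C (e ^ (Fintype.card F ^ i)) * Polynomial.X ^ (Fintype.card F ^ s))

lemma Gam_deg (a b e : L) (ha : a ≠ 0) (s : ℕ) : (Gam F a b e s).natDegree = 2 * Fintype.card F ^ s := by
  have hq : 1 < Fintype.card F := Fintype.one_lt_card
  have hpos : 0 < Fintype.card F ^ s := by positivity
  apply Polynomial.natDegree_eq_of_le_of_coeff_ne_zero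
  · refine Polynomial.natDegree_sum_le_of_forall_le _ _ fun i hi => ?_
    have hi' : Fintype.card F ^ i ≤ Fintype.card F ^ s :=
      Nat.pow_le_pow_right (by omega) (by have := mem_range.mp hi; omega)
    refine (Polynomial.natDegree_sub_le _ _).trans (max_le
      ((Polynomial.natDegree_add_le _ _).trans (max_le ?_ ?_)) ?_) <;>
    · refine (Polynomial.natDegree_C_mul_X_pow_le _ _).trans ?_
      omega
  · simp only [Gam, Polynomial.finsetSum_coeff, Polynomial.coeff_sub, Polynomial.coeff_add,
      Polynomial.coeff_C_mul, Polynomial.coeff_X_pow]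
    rw [sum_range_succ, sum_eq_zero]
    · rw [if_pos (by omega), if_neg (by omega), if_neg (by omega)]
      simpa using ha
    · intro i hi
      have hi' : Fintype.card F ^ i < Fintype.card F ^ s :=
        Nat.pow_lt_pow_right hq (mem_range.mp hi)
      rw [if_neg (by omega), if_neg (by omega), if_neg (by omega)]
      simp

lemma Gam_eval (a b : F) (e : L) (s : ℕ) (x : L) (hx : x ≠ 0) (y : L)
    (h : y ^ (Fintype.card F) - y = algebraMap F L a * x + algebraMap F L b * x⁻¹ - e) :
    x ^ (Fintype.card F ^ s) * y ^ (Fintype.card F ^ (s + 1)) =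
      x ^ (Fintype.card F ^ s) * y + (Gam F (algebraMap F L a) (algebraMap F L b) e s).eval x := by
  rw [as_iter (s + 1) y _ h, mul_add, mul_sum, Gam, Polynomial.eval_finsetSum]
  congr 1
  refine sum_congr rfl fun i hi => ?_
  have hi' : Fintype.card F ^ i ≤ Fintype.card F ^ s :=
      Nat.pow_le_pow_right Fintype.card_pos (by have := mem_range.mp hi; omega)
  have hφ : ∀ u : L, ((FiniteField.frobeniusAlgHom F L) ^ i : L →ₐ[F] L) u = u ^ (Fintype.card F ^ i) := by
    intro u
    simp only [AlgHom.coe_pow, FiniteField.coe_frobeniusAlgHom, pow_iterate]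
  rw [← hφ, map_sub, map_add, map_mul, map_mul, AlgHom.commutes, AlgHom.commutes, hφ, hφ, hφ]
  simp only [Polynomial.eval_sub, Polynomial.eval_add, Polynomial.eval_mul, Polynomial.eval_C,
    Polynomial.eval_pow, Polynomial.eval_X]
  have h1 : x ^ (Fintype.card F ^ s) = x ^ (Fintype.card F ^ s - Fintype.card F ^ i) * x ^ (Fintype.card F ^ i) := by
    rw [← pow_add]; congr 1; omega
  have h2 : x ^ (Fintype.card F ^ i) * x⁻¹ ^ (Fintype.card F ^ i) = 1 := by
    rw [← mul_pow, mul_inv_cancel₀ hx, one_pow]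
  rw [pow_add]
  linear_combination (algebraMap F L b) * x⁻¹ ^ (Fintype.card F ^ i) * h1 +
    (algebraMap F L b) * x ^ (Fintype.card F ^ s - Fintype.card F ^ i) * h2

lemma Xc_bound [DecidableEq L] [DecidableEq F] (a b c : F) (ha : a ≠ 0) (s : ℕ) (hs : 2 ≤ s) (hq3 : 3 ≤ Fintype.card F)
    (hcard : Fintype.card L = (Fintype.card F ^ (s + 1)) ^ 2) :
    Fintype.card F * (univ.filter fun x : L => x ≠ 0 ∧
      Algebra.trace F L (algebraMap F L a * x + algebraMap F L b * x⁻¹) = c).card ≤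
    (Fintype.card F ^ (s + 1)) ^ 2 + (9 * Fintype.card F + 1) * Fintype.card F ^ (s + 1) := by
  obtain ⟨p, hp⟩ := CharP.exists F
  obtain ⟨n, hpp, hn⟩ := FiniteField.card F p
  have : Fact p.Prime := ⟨hpp⟩
  have : CharP L p := charP_of_injective_algebraMap (algebraMap F L).injective p
  obtain ⟨e, he⟩ := Algebra.trace_surjective F L c
  set q := Fintype.card F with hqdef
  have hρ9 : 9 ≤ q ^ s := by
    calc 9 = 3 ^ 2 := by norm_num
      _ ≤ q ^ 2 := Nat.pow_le_pow_left hq3 2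
      _ ≤ q ^ s := Nat.pow_le_pow_right (by omega) hs
  have ha' : algebraMap F L a ≠ 0 := by simpa using ha
  have main := stepanov_core (L := L) p (n * (s + 1)) q (q ^ s) (q ^ s - 2) (q ^ s + 8) (q ^ (s + 1))
    (by omega) (pow_succ' q s) (by rw [hn, ← pow_mul]) (fun z => by
      rw [← pow_two, ← hcard]; exact FiniteField.pow_card z) (by omega)
    (by
      obtain ⟨k, hk⟩ := Nat.exists_eq_add_of_le hρ9
      rw [pow_succ', hk, show 9 + k - 2 = 7 + k by omega]
      nlinarith [Nat.zero_le (q * k), Nat.zero_le k])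
    (Polynomial.C (algebraMap F L a) * Polynomial.X ^ 2 + Polynomial.C (algebraMap F L b)
      - Polynomial.C e * Polynomial.X)
    (Gam F (algebraMap F L a) (algebraMap F L b) e s)
    (by compute_degree) (Gam_deg _ _ _ ha' s)
    (univ.filter fun x : L => x ≠ 0 ∧
      Algebra.trace F L (algebraMap F L a * x + algebraMap F L b * x⁻¹) = c)
    (fun x hx => (mem_filter.mp hx).2.1)
    (fun x => univ.filter fun y : L =>
      y ^ q - y = algebraMap F L a * x + algebraMap F L b * x⁻¹ - e)
    (fun x hx => as_fiber _ (by rw [map_sub, (mem_filter.mp hx).2.2, he, sub_self]))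
    (fun x hx y hy => by
      have hx0 := (mem_filter.mp hx).2.1
      have h1 := (mem_filter.mp hy).2
      simp only [Polynomial.eval_sub, Polynomial.eval_add, Polynomial.eval_mul, Polynomial.eval_C,
        Polynomial.eval_pow, Polynomial.eval_X]
      linear_combination x * h1 + algebraMap F L b * mul_inv_cancel₀ hx0)
    (fun x hx y hy => Gam_eval a b e s x (mem_filter.mp hx).2.1 y (mem_filter.mp hy).2)
  refine (Nat.mul_le_mul_left q main).trans ?_
  obtain ⟨k, hk⟩ := Nat.exists_eq_add_of_le hρ9
  rw [pow_succ', hk, show 9 + k - 2 = 7 + k by omega]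
  nlinarith [Nat.zero_le (q * k), Nat.zero_le k]

end AS


section Weil
variable {F : Type} [Field F] [Fintype F]

lemma Kl_real (ψ : AddChar F ℂ) (a b : F) : (((Kl ψ a b).re : ℝ) : ℂ) = Kl ψ a b := by
  rw [← Complex.conj_eq_iff_re]
  classical
  unfold Kl
  rw [map_sum]
  rw [← Equiv.sum_comp (Equiv.neg F)]
  refine sum_congr rfl fun x _ => ?_
  by_cases hx : x = 0
  · simp [hx]
  · simp only [Equiv.neg_apply, neg_eq_zero, hx, if_false]
    rw [← AddChar.map_neg_eq_conj]
    congr 1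
    rw [inv_neg]; ring

noncomputable def krseq (q : ℕ) (K : ℝ) : ℕ → ℝ
  | 0 => K
  | k + 1 => 2 * (q : ℝ) ^ (2 ^ k) - krseq q K k ^ 2

lemma klseq_real (q : ℕ) (K : ℝ) (k : ℕ) : klseq q (K : ℂ) k = ((krseq q K k : ℝ) : ℂ) := by
  induction k with
  | zero => rfl
  | succ k ih => rw [klseq, krseq, ih]; push_cast; rfl

lemma krseq_growth (q : ℕ) (K δ : ℝ) (hδ : 0 < δ) (hK : (4 + δ) * q ≤ K ^ 2) (j : ℕ) :
    (4 + 4 ^ j * δ) * (q : ℝ) ^ (2 ^ j) ≤ krseq q K j ^ 2 := by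
  induction j with
  | zero => simpa [krseq] using hK
  | succ j ih =>
    rw [krseq]
    have hR : (0 : ℝ) ≤ (q : ℝ) ^ (2 ^ j) := by positivity
    have h4 : (0 : ℝ) < 4 ^ j * δ := by positivity
    have e1 : (q : ℝ) ^ (2 ^ (j + 1)) = ((q : ℝ) ^ (2 ^ j)) ^ 2 := by rw [← pow_mul, pow_succ 2 j]
    have h5 : (2 + 4 ^ j * δ) * (q : ℝ) ^ (2 ^ j) ≤ krseq q K j ^ 2 - 2 * (q : ℝ) ^ (2 ^ j) := by linarith
    have h6 : ((2 + 4 ^ j * δ) * (q : ℝ) ^ (2 ^ j)) ^ 2 ≤ (krseq q K j ^ 2 - 2 * (q : ℝ) ^ (2 ^ j)) ^ 2 :=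
      pow_le_pow_left₀ (by positivity) h5 2
    rw [e1, pow_succ (4:ℝ) j]
    nlinarith [mul_nonneg (sq_nonneg (4 ^ j * δ)) (sq_nonneg ((q : ℝ) ^ (2 ^ j)))]

lemma kl_lower (hodd : Odd (Fintype.card F)) (ψ : AddChar F ℂ) (hψ : ψ ≠ 1) (a b : F)
    (ha : a ≠ 0) (hb : b ≠ 0) (j : ℕ) (hj : 2 ≤ j) :
    -((Fintype.card F : ℝ) * (9 * Fintype.card F + 4)) * (Fintype.card F : ℝ) ^ (2 ^ j) ≤
      krseq (Fintype.card F) (Kl ψ a b).re (j + 1) := by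
  classical
  obtain ⟨L, _, _, _, hc, hL⟩ := tower hodd a b ha hb (j + 1)
  set q := Fintype.card F with hqdef
  have hq1 : 1 < q := Fintype.one_lt_card
  have hq3 : 3 ≤ q := by
    rcases hodd with ⟨k, hk⟩; omega
  set R : ℝ := (q : ℝ) ^ (2 ^ j) with hR
  obtain ⟨s, hs⟩ : ∃ s, 2 ^ j = s + 1 := ⟨2 ^ j - 1, by have := Nat.one_le_two_pow (n := j); omega⟩
  have hs2 : 2 ≤ s := by
    have : 2 ^ 2 ≤ 2 ^ j := Nat.pow_le_pow_right (by norm_num) hj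
    omega
  have hcL : Fintype.card L = (q ^ (s + 1)) ^ 2 := by rw [hc, pow_succ 2 j, pow_mul, hs]
  set g : L → F := fun x => Algebra.trace F L (algebraMap F L a * x + algebraMap F L b * x⁻¹) with hg
  set N : F → ℕ := fun c => (univ.filter fun x : L => x ≠ 0 ∧ g x = c).card with hN
  have hX : ∀ c, (q : ℝ) * N c ≤ R ^ 2 + (9 * q + 1) * R := by
    intro c
    have := Xc_bound (L := L) a b c ha s hs2 hq3 hcL
    rw [← hs] at this
    have h' : q * N c ≤ (q ^ 2 ^ j) ^ 2 + (9 * q + 1) * q ^ 2 ^ j := this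
    rw [hR]
    exact_mod_cast h'
  have hNsum : ∑ c, (N c : ℝ) = R ^ 2 - 1 := by
    have h1 : ∑ c, N c = (univ.filter fun x : L => x ≠ 0).card := by
      rw [card_eq_sum_card_fiberwise (f := g) (t := univ) (fun _ _ => by simp)]
      refine sum_congr rfl fun c _ => ?_
      simp only [hN, filter_filter]
    have h2 : (univ.filter fun x : L => x ≠ 0).card + 1 = Fintype.card L := by
      rw [filter_ne' univ (0 : L), card_erase_of_mem (mem_univ _), card_univ]
      have : 0 < Fintype.card L := Fintype.card_pos
      omega
    rw [← h1, hcL, ← hs] at h2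
    have h3 : (((∑ c, N c) + 1 : ℕ) : ℝ) = (((q ^ 2 ^ j) ^ 2 : ℕ) : ℝ) := by rw [h2]
    push_cast at h3
    rw [hR]; linarith
  have hψc : ∀ c : F, c ≠ 0 → AddChar.mulShift ψ c ≠ 1 := by
    intro c hc0
    exact AddChar.IsPrimitive.of_ne_one hψ hc0
  have hsum : ∑ c : F, Kl ((AddChar.mulShift ψ c).compAddMonoidHom (Algebra.trace F L).toAddMonoidHom)
      (algebraMap F L a) (algebraMap F L b) = (q : ℂ) * N 0 := by
    unfold Kl
    rw [sum_comm]
    have : ∀ x : L, (∑ c : F, if x = 0 then (0:ℂ) else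
        ((AddChar.mulShift ψ c).compAddMonoidHom (Algebra.trace F L).toAddMonoidHom)
          (algebraMap F L a * x + algebraMap F L b * x⁻¹)) =
        if (x ≠ 0 ∧ g x = 0) then (q : ℂ) else 0 := by
      intro x
      by_cases hx : x = 0
      · simp [hx]
      · simp only [hx, if_false]
        have h1 := AddChar.sum_mulShift (g x) (AddChar.IsPrimitive.of_ne_one hψ)
        simp only [hg] at h1 ⊢
        simp only [ne_eq, hx, not_false_eq_true, true_and]
        refine Eq.trans ?_ (h1.trans ?_)
        · refine sum_congr rfl fun c _ => ?_
          simp [AddChar.mulShift_apply]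
        · split_ifs <;> simp [hqdef]
    simp_rw [this]
    rw [← sum_filter, sum_const, nsmul_eq_mul, mul_comm]
  have h0 : Kl ((AddChar.mulShift ψ 0).compAddMonoidHom (Algebra.trace F L).toAddMonoidHom)
      (algebraMap F L a) (algebraMap F L b) = ((R ^ 2 - 1 : ℝ) : ℂ) := by
    have h1 : Kl ((AddChar.mulShift ψ 0).compAddMonoidHom (Algebra.trace F L).toAddMonoidHom)
      (algebraMap F L a) (algebraMap F L b) = ∑ x : L, ((1 : ℂ) - if x = 0 then 1 else 0) := by
      unfold Kl
      refine sum_congr rfl fun x _ => ?_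
      by_cases hx : x = 0
      · simp [hx]
      · simp [hx, AddChar.mulShift_apply]
    rw [h1, sum_sub_distrib, sum_const, sum_ite_eq' univ (0:L), if_pos (mem_univ _), card_univ, hcL, hR, hs]
    simp
  set kr : F → ℝ := fun c => krseq q (Kl (AddChar.mulShift ψ c) a b).re (j + 1) with hkr
  have hcne : ∀ c : F, c ≠ 0 → Kl ((AddChar.mulShift ψ c).compAddMonoidHom
      (Algebra.trace F L).toAddMonoidHom) (algebraMap F L a) (algebraMap F L b) = ((kr c : ℝ) : ℂ) := by
    intro c hc0
    rw [hL _ (hψc c hc0), ← Kl_real, klseq_real]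
  have hkrle : ∀ c, kr c ≤ 2 * R := by
    intro c
    simp only [hkr, krseq]
    nlinarith [sq_nonneg (krseq q (Kl (AddChar.mulShift ψ c) a b).re j)]
  have htot : (R ^ 2 - 1) + ∑ c ∈ univ.erase (0 : F), kr c = q * N 0 := by
    rw [← add_sum_erase univ _ (mem_univ (0 : F)), h0,
      sum_congr rfl (fun c hc => hcne c (ne_of_mem_erase hc))] at hsum
    exact_mod_cast hsum
  have h1m : (1 : F) ∈ univ.erase (0 : F) := by simp
  rw [← add_sum_erase _ _ h1m] at htot
  have hk1 : kr 1 = krseq q (Kl ψ a b).re (j + 1) := by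
    simp only [hkr]
    rw [show AddChar.mulShift ψ 1 = ψ by ext x; simp [AddChar.mulShift_apply]]
  have hcard0 : ((univ.erase (0 : F)).card : ℝ) = q - 1 := by
    rw [card_erase_of_mem (mem_univ _), card_univ, ← hqdef, Nat.cast_sub hq1.le]; simp
  have hcard1 : (((univ.erase (0 : F)).erase 1).card : ℝ) = q - 2 := by
    rw [card_erase_of_mem h1m, card_erase_of_mem (mem_univ _), card_univ, ← hqdef,
      Nat.sub_sub, Nat.cast_sub (by omega)]; simp
  have hs1 : ∑ c ∈ (univ.erase (0 : F)).erase 1, kr c ≤ (q - 2) * (2 * R) := by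
    rw [← hcard1, ← nsmul_eq_mul]
    exact sum_le_card_nsmul _ _ _ fun c _ => hkrle c
  have hs0 : ∑ c ∈ univ.erase (0 : F), (q : ℝ) * N c ≤ (q - 1) * (R ^ 2 + (9 * q + 1) * R) := by
    rw [← hcard0, ← nsmul_eq_mul]
    exact sum_le_card_nsmul _ _ _ fun c _ => hX c
  rw [← mul_sum] at hs0
  rw [← add_sum_erase univ _ (mem_univ (0 : F))] at hNsum
  have hNs : ∑ c ∈ univ.erase (0 : F), (N c : ℝ) = R ^ 2 - 1 - N 0 := by linarith
  rw [hNs] at hs0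
  rw [← hk1]
  have hq3' : (3 : ℝ) ≤ q := by exact_mod_cast hq3
  have hR1 : (1 : ℝ) ≤ R := one_le_pow₀ (by linarith)
  have hRq : (q : ℝ) ≤ q * R := by nlinarith
  nlinarith

theorem weil (hodd : Odd (Fintype.card F)) (ψ : AddChar F ℂ) (hψ : ψ ≠ 1) (a b : F)
    (ha : a ≠ 0) (hb : b ≠ 0) : (Kl ψ a b).re ^ 2 ≤ 4 * Fintype.card F := by
  by_contra hlt
  push Not at hlt
  set q := Fintype.card F with hqdef
  have hq0 : (0 : ℝ) < q := by exact_mod_cast (Fintype.card_pos (α := F))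
  set δ : ℝ := (Kl ψ a b).re ^ 2 / q - 4 with hδ
  have hδ0 : 0 < δ := by
    rw [hδ, sub_pos, lt_div_iff₀ hq0]; exact hlt
  have hK : (4 + δ) * q ≤ (Kl ψ a b).re ^ 2 := by
    rw [hδ]; apply le_of_eq; field_simp; ring
  obtain ⟨n, hn⟩ := pow_unbounded_of_one_lt (((q : ℝ) * (9 * q + 4)) / δ) (by norm_num : (1:ℝ) < 4)
  rw [div_lt_iff₀ hδ0] at hn
  have h1 := krseq_growth q _ δ hδ0 hK (n + 2)
  have h2 := kl_lower hodd ψ hψ a b ha hb (n + 2) (by omega)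
  rw [← hqdef, krseq] at h2
  have hR : (0 : ℝ) < (q : ℝ) ^ (2 ^ (n + 2)) := by positivity
  have h3 : (4:ℝ) ^ n * δ ≤ 4 ^ (n + 2) * δ := by
    apply mul_le_mul_of_nonneg_right _ hδ0.le
    exact pow_le_pow_right₀ (by norm_num) (by omega)
  have h4 : (4 + 4 ^ (n + 2) * δ - 2 - (q : ℝ) * (9 * q + 4)) * (q : ℝ) ^ (2 ^ (n + 2)) ≤ 0 := by
    linarith
  nlinarith

end Weil

section Final
variable {F : Type} [Field F] [Fintype F] 

lemma gauss_sq (h2 : ringChar F ≠ 2) : ∃ ε : ℂ, ‖ε‖ = 1 ∧ ∀ ψ : AddChar F ℂ, ψ.IsPrimitive →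
    ∀ s : F, s ≠ 0 → (∑ x, ψ (s * x ^ 2)) ^ 2 = ε * (Fintype.card F : ℂ) := by
  classical
  set χ : MulChar F ℂ := (quadraticChar F).ringHomComp (Int.castRingHom ℂ) with hχ
  have hχ1 : χ ≠ 1 := (MulChar.ringHomComp_ne_one_iff Int.cast_injective).mpr (quadraticChar_ne_one h2)
  have hχ2 : χ.IsQuadratic := (quadraticChar_isQuadratic F).comp _
  refine ⟨χ (-1), ?_, fun ψ hψ s hs => ?_⟩
  · have : (-1 : F) ≠ 0 := by simp
    simp only [hχ, MulChar.ringHomComp_apply]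
    rcases quadraticChar_dichotomy this with h | h <;> rw [h] <;> simp
  · have hp : (AddChar.mulShift ψ s).IsPrimitive :=
      AddChar.IsPrimitive.of_ne_one (hψ hs)
    rw [← gaussSum_sq hχ1 hχ2 hp]
    congr 1
    have h1 : ∑ v, ψ (s * v ^ 2) = ∑ w, ∑ v with v ^ 2 = w, ψ (s * v ^ 2) :=
      (Finset.sum_fiberwise (s := univ) (fun v : F => v ^ 2) (fun v => ψ (s * v ^ 2))).symm
    rw [h1]
    have h4 : ∀ w : F, ∑ v with v ^ 2 = w, ψ (s * v ^ 2) = ψ (w * s) + χ w * (AddChar.mulShift ψ s) w := by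
      intro w
      rw [Finset.sum_congr rfl (g := fun _ => ψ (s * w))
        (fun v hv => by rw [(Finset.mem_filter.mp hv).2])]
      have := quadraticChar_card_sqrts h2 w
      rw [Finset.sum_const, nsmul_eq_mul]
      have h3 : ((({x : F | x ^ 2 = w}.toFinset).card : ℤ) : ℂ) = ((quadraticChar F w + 1 : ℤ) : ℂ) := by
        rw [this]
      have h5 : ({x : F | x ^ 2 = w}.toFinset) = univ.filter (fun v : F => v ^ 2 = w) := by
        ext; simp
      rw [h5] at h3
      push_cast at h3
      rw [h3, AddChar.mulShift_apply, hχ, MulChar.ringHomComp_apply, mul_comm w s]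
      simp only [eq_intCast]
      ring
    simp_rw [h4]
    rw [sum_add_distrib, AddChar.sum_mulShift _ hψ, if_neg hs, gaussSum]
    simp

lemma complete_sq (h2 : (2 : F) ≠ 0) (ψ : AddChar F ℂ) (s ξ : F) (hs : s ≠ 0) :
    ∑ x, ψ (s * x ^ 2 + x * ξ) = ψ (-(ξ ^ 2 / 4) * s⁻¹) * ∑ x, ψ (s * x ^ 2) := by
  rw [mul_sum, ← Equiv.sum_comp (Equiv.addRight (-(ξ / (2 * s))))]
  refine sum_congr rfl fun x _ => ?_
  rw [← AddChar.map_add_eq_mul]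
  congr 1
  simp only [Equiv.coe_addRight]
  have h4 : (4 : F) ≠ 0 := by
    rw [show (4 : F) = 2 * 2 by norm_num]; exact mul_ne_zero h2 h2
  field_simp
  ring

lemma sphere_hat [DecidableEq F] (h2 : ringChar F ≠ 2) (t : F) : ∃ ε : ℂ, ‖ε‖ = 1 ∧ ∀ ψ : AddChar F ℂ, ψ.IsPrimitive →
    ∀ ξ : F × F, ∑ u : F × F with nrm u = t, ψ (u.1 * ξ.1 + u.2 * ξ.2) =
      (if ξ = 0 then (Fintype.card F : ℂ) else 0) + ε * Kl ψ (-t) (-(nrm ξ / 4)) := by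
  obtain ⟨ε, hε, hG⟩ := gauss_sq h2
  refine ⟨ε, hε, fun ψ hψ ξ => ?_⟩
  have h2' : (2 : F) ≠ 0 := Ring.two_ne_zero h2
  have hq : (Fintype.card F : ℂ) ≠ 0 := by simp
  apply mul_left_cancel₀ hq
  have e1 : (Fintype.card F : ℂ) * ∑ u : F × F with nrm u = t, ψ (u.1 * ξ.1 + u.2 * ξ.2) =
      ∑ s : F, ∑ u : F × F, ψ (s * (nrm u - t)) * ψ (u.1 * ξ.1 + u.2 * ξ.2) := by
    rw [sum_comm, mul_sum, sum_filter]
    refine sum_congr rfl fun u _ => ?_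
    rw [← sum_mul, AddChar.sum_mulShift _ hψ]
    simp only [sub_eq_zero]
    split_ifs <;> simp
  have e2 : ∀ s : F, ∑ u : F × F, ψ (s * (nrm u - t)) * ψ (u.1 * ξ.1 + u.2 * ξ.2) =
      ψ (-t * s) * ((∑ x, ψ (s * x ^ 2 + x * ξ.1)) * (∑ y, ψ (s * y ^ 2 + y * ξ.2))) := by
    intro s
    rw [sum_mul_sum, Fintype.sum_prod_type, mul_sum]
    refine sum_congr rfl fun x _ => ?_
    rw [mul_sum]
    refine sum_congr rfl fun y _ => ?_
    rw [← AddChar.map_add_eq_mul, ← AddChar.map_add_eq_mul, ← AddChar.map_add_eq_mul]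
    congr 1
    simp only [nrm]
    ring
  rw [e1]
  simp_rw [e2]
  rw [← add_sum_erase univ _ (mem_univ (0 : F))]
  rw [mul_add]
  congr 1
  · simp only [mul_zero, zero_mul, zero_add, AddChar.map_zero_eq_one, one_mul]
    rw [AddChar.sum_mulShift _ hψ, AddChar.sum_mulShift _ hψ]
    have : ξ = 0 ↔ ξ.1 = 0 ∧ ξ.2 = 0 := Prod.ext_iff
    simp only [this]
    by_cases h1 : ξ.1 = 0 <;> by_cases h2 : ξ.2 = 0 <;> simp [h1, h2]
  · unfold Kl
    rw [← add_sum_erase univ _ (mem_univ (0 : F)), if_pos rfl, zero_add, mul_sum, mul_sum]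
    refine sum_congr rfl fun s hs => ?_
    have hs0 := ne_of_mem_erase hs
    rw [if_neg hs0, complete_sq h2' ψ s _ hs0, complete_sq h2' ψ s _ hs0]
    have h3 := hG ψ hψ s hs0
    have h5 : ψ (-t * s + -(nrm ξ / 4) * s⁻¹) = ψ (-t * s) * (ψ (-(ξ.1 ^ 2 / 4) * s⁻¹) * ψ (-(ξ.2 ^ 2 / 4) * s⁻¹)) := by
      rw [← AddChar.map_add_eq_mul, ← AddChar.map_add_eq_mul]
      congr 1
      simp only [nrm]
      ring
    rw [h5]
    linear_combination (ψ (-t * s) * (ψ (-(ξ.1 ^ 2 / 4) * s⁻¹) * ψ (-(ξ.2 ^ 2 / 4) * s⁻¹))) * h3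

lemma Kl_zero (ψ : AddChar F ℂ) (hψ : ψ.IsPrimitive) (a : F) (ha : a ≠ 0) : Kl ψ a 0 = -1 := by
  classical
  have h := AddChar.sum_mulShift a hψ
  rw [if_neg ha, ← add_sum_erase univ _ (mem_univ (0 : F))] at h
  unfold Kl
  rw [← add_sum_erase univ _ (mem_univ (0 : F)), if_pos rfl, zero_add]
  simp only [zero_mul, AddChar.map_zero_eq_one, Nat.cast_zero] at h
  rw [eq_neg_iff_add_eq_zero, add_comm, ← h]
  congr 1
  refine sum_congr rfl fun s hs => ?_
  rw [if_neg (ne_of_mem_erase hs), mul_comm]; simp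

lemma Kl_norm (hodd : Odd (Fintype.card F)) (ψ : AddChar F ℂ) (hψ : ψ.IsPrimitive) (a b : F) (ha : a ≠ 0) :
    ‖Kl ψ a b‖ ≤ 2 * √(Fintype.card F) := by
  have hq : (1 : ℝ) ≤ Fintype.card F := by exact_mod_cast (Fintype.card_pos (α := F))
  have h1 : (1 : ℝ) ≤ √(Fintype.card F) := Real.one_le_sqrt.mpr hq
  by_cases hb : b = 0
  · rw [hb, Kl_zero ψ hψ a ha, norm_neg, norm_one]; linarith
  · have hψ1 : ψ ≠ 1 := by
      have := hψ (one_ne_zero)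
      rwa [AddChar.mulShift_one] at this
    have h := weil hodd ψ hψ1 a b ha hb
    rw [← Kl_real, Complex.norm_real, Real.norm_eq_abs]
    apply abs_le_of_sq_le_sq _ (by positivity)
    rw [mul_pow, Real.sq_sqrt (by linarith)]
    linarith

lemma orth2 [DecidableEq F] (ψ : AddChar F ℂ) (hψ : ψ.IsPrimitive) (w : F × F) :
    ∑ ξ : F × F, ψ (w.1 * ξ.1 + w.2 * ξ.2) = if w = 0 then (Fintype.card F : ℂ) ^ 2 else 0 := by
  rw [Fintype.sum_prod_type]
  have : ∀ x y : F, ψ (w.1 * x + w.2 * y) = ψ (x * w.1) * ψ (y * w.2) := by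
    intro x y
    rw [← AddChar.map_add_eq_mul]; congr 1; ring
  simp only [this]
  rw [← sum_mul_sum, AddChar.sum_mulShift _ hψ, AddChar.sum_mulShift _ hψ]
  have : w = 0 ↔ w.1 = 0 ∧ w.2 = 0 := Prod.ext_iff
  simp only [this]
  by_cases h1 : w.1 = 0 <;> by_cases h2 : w.2 = 0 <;> simp [h1, h2, pow_two]

noncomputable def Eh (ψ : AddChar F ℂ) (E : Finset (F × F)) (ξ : F × F) : ℂ :=
  ∑ x ∈ E, ψ (x.1 * ξ.1 + x.2 * ξ.2)

lemma Eh_sq (ψ : AddChar F ℂ) (E : Finset (F × F)) (ξ : F × F) :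
    ((‖Eh ψ E ξ‖ ^ 2 : ℝ) : ℂ) = ∑ x ∈ E, ∑ z ∈ E, ψ ((x - z).1 * ξ.1 + (x - z).2 * ξ.2) := by
  push_cast
  rw [← Complex.mul_conj', Eh, map_sum, sum_mul_sum]
  refine sum_congr rfl fun x _ => sum_congr rfl fun z _ => ?_
  rw [← AddChar.map_neg_eq_conj, ← AddChar.map_add_eq_mul]
  congr 1
  simp only [Prod.fst_sub, Prod.snd_sub]
  ring

lemma parseval (ψ : AddChar F ℂ) (hψ : ψ.IsPrimitive) (E : Finset (F × F)) :
    ∑ ξ, ‖Eh ψ E ξ‖ ^ 2 = (Fintype.card F : ℝ) ^ 2 * E.card := by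
  classical
  have : ((∑ ξ, ‖Eh ψ E ξ‖ ^ 2 : ℝ) : ℂ) = (((Fintype.card F : ℝ) ^ 2 * E.card : ℝ) : ℂ) := by
    rw [Complex.ofReal_sum]
    simp_rw [Eh_sq]
    rw [sum_comm]
    have : ∀ x ∈ E, ∑ ξ : F × F, ∑ z ∈ E, ψ ((x - z).1 * ξ.1 + (x - z).2 * ξ.2) = (Fintype.card F : ℂ) ^ 2 := by
      intro x hx
      rw [sum_comm]
      simp_rw [orth2 ψ hψ, sub_eq_zero]
      rw [sum_ite_eq, if_pos hx]
    rw [sum_congr rfl this, sum_const, nsmul_eq_mul]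
    push_cast
    ring
  exact_mod_cast this

lemma count [DecidableEq F] (ψ : AddChar F ℂ) (hψ : ψ.IsPrimitive) (E : Finset (F × F)) (S : Finset (F × F)) :
    ∑ ξ : F × F, (∑ u ∈ S, ψ (u.1 * ξ.1 + u.2 * ξ.2)) * ((‖Eh ψ E ξ‖ ^ 2 : ℝ) : ℂ) =
      (Fintype.card F : ℂ) ^ 2 * ∑ u ∈ S, ((E ∩ E.image (fun x => x - u)).card : ℂ) := by
  simp_rw [Eh_sq, sum_mul]
  rw [sum_comm, mul_sum]
  refine sum_congr rfl fun u _ => ?_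
  simp_rw [mul_sum]
  rw [sum_comm]
  have h1 : ∀ x ∈ E, ∑ ξ : F × F, ∑ z ∈ E, ψ (u.1 * ξ.1 + u.2 * ξ.2) * ψ ((x - z).1 * ξ.1 + (x - z).2 * ξ.2)
      = if x ∈ E.image (fun x => x - u) then (Fintype.card F : ℂ) ^ 2 else 0 := by
    intro x hx
    rw [sum_comm]
    have h2 : ∀ z ∈ E, ∑ ξ : F × F, ψ (u.1 * ξ.1 + u.2 * ξ.2) * ψ ((x - z).1 * ξ.1 + (x - z).2 * ξ.2) =
        if x + u = z then (Fintype.card F : ℂ) ^ 2 else 0 := by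
      intro z _
      have h3 : x + u = z ↔ u + (x - z) = 0 := by
        rw [← sub_eq_zero, show x + u - z = u + (x - z) by abel]
      simp only [h3]
      rw [← orth2 ψ hψ]
      refine sum_congr rfl fun ξ _ => ?_
      rw [← AddChar.map_add_eq_mul]
      congr 1
      simp only [Prod.fst_add, Prod.snd_add]
      ring
    rw [sum_congr rfl h2, sum_ite_eq]
    have h4 : x + u ∈ E ↔ x ∈ E.image (fun x => x - u) := by
      rw [mem_image]
      constructor
      · intro h; exact ⟨x + u, h, by abel⟩
      · rintro ⟨y, hy, rfl⟩; simpa using hy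
    simp only [h4]
  rw [sum_congr rfl h1, ← sum_filter, sum_const, nsmul_eq_mul, mul_comm, filter_mem_eq_inter]

end Final

theorem exists_popular_difference
    {F : Type} [Field F] [Fintype F] [DecidableEq F]
    (hq : Odd (Fintype.card F)) (t : F) (ht : t ≠ 0)
    (E : Finset (F × F))
    (hE : 4 * (Fintype.card F : ℝ) ^ ((3 : ℝ) / 2) ≤ (E.card : ℝ)) :
    ∃ u : F × F, nrm u = t ∧
      ((E.card : ℝ) ^ 2 / (4 * (Fintype.card F : ℝ) ^ 2) ≤
        ((E ∩ E.image (fun x => x - u)).card : ℝ)) := by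
  have h2 : ringChar F ≠ 2 := by
    intro h
    have := FiniteField.even_card_iff_char_two.mp h
    rcases hq with ⟨k, hk⟩
    omega
  have hψ : (AddChar.FiniteField.primitiveChar_to_Complex F).IsPrimitive :=
    AddChar.FiniteField.primitiveChar_to_Complex_isPrimitive F
  set ψ := AddChar.FiniteField.primitiveChar_to_Complex F
  obtain ⟨ε, hε, hS⟩ := sphere_hat h2 t
  have hS := hS ψ hψ
  set S : Finset (F × F) := univ.filter fun u => nrm u = t with hSdef
  set q : ℝ := (Fintype.card F : ℝ) with hqdef
  have hq3 : (3 : ℝ) ≤ q := by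
    have h1 : 1 < Fintype.card F := Fintype.one_lt_card
    have : 3 ≤ Fintype.card F := by rcases hq with ⟨k, hk⟩; omega
    rw [hqdef]; exact_mod_cast this
  have hnt : -t ≠ 0 := neg_ne_zero.mpr ht
  have hq0 : 0 < q := by linarith
  set r := √q with hr
  have hr2 : r ^ 2 = q := Real.sq_sqrt hq0.le
  have hr0 : 0 < r := Real.sqrt_pos.mpr hq0
  have hE' : 4 * (q * r) ≤ (E.card : ℝ) := by
    have : q ^ ((3 : ℝ) / 2) = q * r := by
      rw [hr, Real.sqrt_eq_rpow, show (3 : ℝ) / 2 = 1 + 1 / 2 by norm_num, Real.rpow_add hq0, Real.rpow_one]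
    rwa [this] at hE
  by_contra hcon
  push Not at hcon
  set f : F × F → ℝ := fun u => ((E ∩ E.image (fun x => x - u)).card : ℝ) with hf
  set W : F × F → ℂ := fun ξ => ε * Kl ψ (-t) (-(nrm ξ / 4)) with hW
  have hWn : ∀ ξ, ‖W ξ‖ ≤ 2 * r := by
    intro ξ
    simp only [hW]
    rw [norm_mul, hε, one_mul]
    exact Kl_norm hq ψ hψ _ _ hnt
  have hScard : (S.card : ℝ) ≤ q + 1 := by
    have h := hS 0
    have hK : Kl ψ (-t) (-(nrm (0 : F × F) / 4)) = -1 := by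
      rw [show -(nrm (0 : F × F) / 4) = 0 by simp [nrm], Kl_zero ψ hψ _ hnt]
    rw [hK] at h
    simp only [Prod.fst_zero, Prod.snd_zero, mul_zero, add_zero, AddChar.map_zero_eq_one, sum_const,
      nsmul_eq_mul, mul_one, if_true] at h
    have h3 : ‖(S.card : ℂ)‖ ≤ ‖(Fintype.card F : ℂ)‖ + ‖ε * -1‖ := by
      rw [h]; exact norm_add_le _ _
    rw [norm_mul, hε] at h3
    simpa using h3
  have hN : ∑ u ∈ S, f u ≤ (q + 1) * ((E.card : ℝ) ^ 2 / (4 * q ^ 2)) := by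
    calc ∑ u ∈ S, f u ≤ S.card • ((E.card : ℝ) ^ 2 / (4 * q ^ 2)) :=
          sum_le_card_nsmul _ _ _ fun u hu => (hcon u (mem_filter.mp hu).2).le
      _ ≤ _ := by
        rw [nsmul_eq_mul]
        exact mul_le_mul_of_nonneg_right hScard (by positivity)
  have hc := count ψ hψ E S
  simp_rw [hS, add_mul] at hc
  rw [sum_add_distrib] at hc
  have hE0 : Eh ψ E 0 = E.card := by simp [Eh]
  have h5 : ∑ ξ : F × F, (if ξ = 0 then (Fintype.card F : ℂ) else 0) * ((‖Eh ψ E ξ‖ ^ 2 : ℝ) : ℂ) =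
      ((q * (E.card : ℝ) ^ 2 : ℝ) : ℂ) := by
    simp_rw [ite_mul, zero_mul]
    rw [sum_ite_eq' univ (0 : F × F), if_pos (mem_univ _), hE0]
    simp [hqdef]
  rw [h5] at hc
  have h6 : ‖∑ ξ : F × F, W ξ * ((‖Eh ψ E ξ‖ ^ 2 : ℝ) : ℂ)‖ ≤ 2 * r * (q ^ 2 * E.card) := by
    rw [← parseval ψ hψ E, mul_sum]
    refine (norm_sum_le _ _).trans (sum_le_sum fun ξ _ => ?_)
    rw [norm_mul, Complex.norm_real, Real.norm_eq_abs, abs_of_nonneg (by positivity)]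
    exact mul_le_mul_of_nonneg_right (hWn ξ) (by positivity)
  have h7 : ∑ ξ : F × F, W ξ * ((‖Eh ψ E ξ‖ ^ 2 : ℝ) : ℂ) =
      ((q ^ 2 * ∑ u ∈ S, f u - q * (E.card : ℝ) ^ 2 : ℝ) : ℂ) := by
    push_cast
    push_cast at hc
    simp only [hf, hqdef]
    push_cast
    linear_combination hc
  rw [h7, Complex.norm_real, Real.norm_eq_abs] at h6
  have h8 := (abs_le.mp h6).1
  have h9 : q ^ 2 * ∑ u ∈ S, f u ≤ (q + 1) * (E.card : ℝ) ^ 2 / 4 := by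
    calc _ ≤ q ^ 2 * ((q + 1) * ((E.card : ℝ) ^ 2 / (4 * q ^ 2))) :=
          mul_le_mul_of_nonneg_left hN (by positivity)
      _ = _ := by field_simp
  set e : ℝ := (E.card : ℝ) with he
  have he0 : 0 < e := lt_of_lt_of_le (by positivity) hE'
  have h10 : e * ((3 * q - 1) * e) ≤ e * (8 * r * q ^ 2) := by nlinarith
  have h11 := le_of_mul_le_mul_left h10 he0
  have h12 : (3 * q - 1) * (4 * (q * r)) ≤ (3 * q - 1) * e :=
    mul_le_mul_of_nonneg_left hE' (by linarith)
  have h13 : 0 < q * r := by positivity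
  nlinarith
end
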